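/- There exist a discrete set Σ ⊂ ℂ² and a complex line Λ ⊂ ℂ² intersecting the variety {zw = 0} exactly in the two points p = (1,0) and q = (0,1), with Σ ∩ Λ = {p,q}, such that for the Stein manifold X = (ℂ*)² = ℂ²∖{zw=0} and its closed complex submanifold X₀ = Λ∖{p,q}, the inclusion map f₀: X₀ ↪ ℂ²∖Σ extends to a continuous map X → ℂ²∖Σ but admits no holomorphic extension f: X → ℂ²∖Σ. Consequently, for each n ≥ 1 there is a discrete set Σ ⊂ ℂⁿ for which the extension theorem for maps of Stein manifolds into ℂⁿ∖Σ fails. -/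

import Mathlib

open scoped Manifold
open Bundle Topology Set Function TopologicalSpace

noncomputable section

/-! ### Core notions of complex analysis on manifolds.

A complex manifold is encoded as a charted space over a complex normed space `E`
whose transition functions are `ℂ`-smooth, i.e. `[SmoothManifoldWithCorners 𝓘(ℂ, E) M]`;
over `ℂ` such smoothness means that the transition maps are holomorphic.
A map is holomorphic iff it is differentiable over `ℂ` in this sense. -/

section Core

variable (E : Type*) [NormedAddCommGroup E] [NormedSpace ℂ E]
  (E' : Type*) [NormedAddCommGroup E'] [NormedSpace ℂ E']
  (M : Type*) [TopologicalSpace M] [ChartedSpace E M]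
  (M' : Type*) [TopologicalSpace M'] [ChartedSpace E' M']

variable {M M'}

/-- A map between complex manifolds is holomorphic if it is `ℂ`-differentiable. -/
def Holomorphic (f : M → M') : Prop :=
  MDifferentiable 𝓘(ℂ, E) 𝓘(ℂ, E') f

/-- Holomorphy on a subset (intended for open subsets). -/
def HolomorphicOn (f : M → M') (s : Set M) : Prop :=
  MDifferentiableOn 𝓘(ℂ, E) 𝓘(ℂ, E') f s

/-- A map is holomorphic on a (possibly singular) complex subvariety `A` if near each
point of `A` it agrees on `A` with a map holomorphic in an ambient neighborhood. -/
def HolomorphicOnSubvariety (f : M → M') (A : Set M) : Prop :=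
  ∀ x ∈ A, ∃ U, IsOpen U ∧ x ∈ U ∧
    ∃ g : M → M', HolomorphicOn E E' g U ∧ EqOn f g (A ∩ U)

/-- A closed complex subvariety: a closed set which is locally the common zero set of
finitely many holomorphic functions. -/
def IsClosedComplexSubvariety (A : Set M) : Prop :=
  IsClosed A ∧ ∀ x ∈ A, ∃ U, IsOpen U ∧ x ∈ U ∧ ∃ (n : ℕ) (g : Fin n → M → ℂ),
    (∀ i, HolomorphicOn E ℂ (g i) U) ∧ A ∩ U = {y ∈ U | ∀ i, g i y = 0}

variable (M) in
/-- A Stein manifold: a complex manifold admitting a proper holomorphic embedding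
(injective immersion with closed image) into some `ℂ^N`. -/
def IsSteinManifold : Prop :=
  ∃ (N : ℕ) (g : M → (Fin N → ℂ)), Holomorphic E (Fin N → ℂ) g ∧ IsClosedEmbedding g ∧
    ∀ x, Function.Injective (mfderiv 𝓘(ℂ, E) 𝓘(ℂ, Fin N → ℂ) g x)

/-- A compact set `K` is `O(X)`-convex if it coincides with its holomorphically convex
hull: every point outside `K` is separated from `K` by a global holomorphic function. -/
def IsOXConvex (K : Set M) : Prop :=
  IsCompact K ∧ ∀ x ∉ K, ∃ f : M → ℂ, Holomorphic E ℂ f ∧ ∀ y ∈ K, ‖f y‖ < ‖f x‖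

end Core

/-- `d` is a metric on `Z` compatible with the given topology. -/
def IsCompatibleMetric {Z : Type*} [t : TopologicalSpace Z] (d : Z → Z → ℝ) : Prop :=
  ∃ m : MetricSpace Z, (∀ a b, m.toPseudoMetricSpace.toDist.dist a b = d a b) ∧
    m.toPseudoMetricSpace.toUniformSpace.toTopologicalSpace = t

section Submanifold

variable (E : Type*) [NormedAddCommGroup E] [NormedSpace ℂ E]
  {M : Type*} [TopologicalSpace M] [ChartedSpace E M]

/-- A closed complex submanifold: a closed set which is locally the zero set of a
holomorphic submersion into some `ℂ^n`. -/
def IsClosedComplexSubmanifold (A : Set M) : Prop :=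
  IsClosed A ∧ ∀ x ∈ A, ∃ U, IsOpen U ∧ x ∈ U ∧ ∃ (n : ℕ) (g : M → (Fin n → ℂ)),
    HolomorphicOn E (Fin n → ℂ) g U ∧
    (∀ y ∈ U, Function.Surjective (mfderivWithin 𝓘(ℂ, E) 𝓘(ℂ, Fin n → ℂ) g U y)) ∧
    A ∩ U = {y ∈ U | g y = 0}

end Submanifold

/-- `(ℂ*)² = ℂ² \ {zw = 0}`, an open Stein submanifold of `ℂ²`. -/
def CStarSq : TopologicalSpace.Opens (ℂ × ℂ) :=
  ⟨{z | z.1 ≠ 0 ∧ z.2 ≠ 0}, by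
    have hrepr : {z : ℂ × ℂ | z.1 ≠ 0 ∧ z.2 ≠ 0} =
        (Prod.fst ⁻¹' ({0}ᶜ : Set ℂ)) ∩ (Prod.snd ⁻¹' ({0}ᶜ : Set ℂ)) := rfl
    rw [hrepr]
    exact (isOpen_compl_singleton.preimage continuous_fst).inter
      (isOpen_compl_singleton.preimage continuous_snd)⟩

/-- A set is discrete and closed in the ambient space. -/
def IsClosedDiscrete {α : Type*} [TopologicalSpace α] (s : Set α) : Prop :=
  IsClosed s ∧ ∀ z ∈ s, ∃ U, IsOpen U ∧ z ∈ U ∧ s ∩ U = {z}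

/-! ### Holomorphic maps of several variables -/

section SeveralVariables

open Metric Filter

theorem exists_norm_le_closedBall {V W : Type*} [NormedAddCommGroup V] [NormedSpace ℂ V]
    [NormedAddCommGroup W] [FiniteDimensional ℂ V] {F : V → W} (hF : Continuous F) (c : V)
    (ρ : ℝ) : ∃ M, ∀ y ∈ closedBall c ρ, ‖F y‖ ≤ M := by
  have := FiniteDimensional.proper ℂ V
  obtain ⟨M, hM⟩ := (isCompact_closedBall c ρ).exists_bound_of_continuousOn hF.continuousOn
  exact ⟨M, hM⟩

variable {V W : Type*} [NormedAddCommGroup V] [NormedSpace ℂ V]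
  [NormedAddCommGroup W] [NormedSpace ℂ W]

theorem hasDerivAt_comp_add_smul {F : V → W} {x : V} (hF : DifferentiableAt ℂ F x) (v : V) :
    HasDerivAt (fun t : ℂ => F (x + t • v)) (fderiv ℂ F x v) 0 := by
  have h1 : HasDerivAt (fun t : ℂ => x + t • v) v 0 := by
    simpa using ((hasDerivAt_id (0 : ℂ)).smul_const v).const_add x
  have h2 : HasFDerivAt F (fderiv ℂ F x) (x + (0 : ℂ) • v) := by
    simpa using hF.hasFDerivAt
  exact h2.comp_hasDerivAt 0 h1

/-- Cauchy's estimate for the Fréchet derivative. -/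
theorem norm_fderiv_le_of_norm_le_closedBall {F : V → W} (hF : Differentiable ℂ F) {x : V}
    {ρ M : ℝ} (hρ : 0 < ρ) (hM : ∀ y ∈ closedBall x ρ, ‖F y‖ ≤ M) : ‖fderiv ℂ F x‖ ≤ M / ρ := by
  have hM0 : 0 ≤ M := (norm_nonneg _).trans (hM x (mem_closedBall_self hρ.le))
  refine ContinuousLinearMap.opNorm_le_bound _ (by positivity) fun v => ?_
  rcases eq_or_ne v 0 with rfl | hv
  · simp
  have hv' : 0 < ‖v‖ := norm_pos_iff.mpr hv
  have hline := hasDerivAt_comp_add_smul (hF x) v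
  have hd : Differentiable ℂ (fun t : ℂ => F (x + t • v)) := by fun_prop
  have := Complex.norm_deriv_le_of_forall_mem_sphere_norm_le (c := 0) (R := ρ / ‖v‖) (C := M)
    (by positivity) hd.diffContOnCl (fun z hz => hM _ (by
      have : ‖z‖ = ρ / ‖v‖ := by simpa using hz
      simp [norm_smul, this, hv'.ne']))
  rw [hline.deriv] at this
  calc _ ≤ M / (ρ / ‖v‖) := this
    _ = M / ρ * ‖v‖ := by field_simp

theorem norm_sub_le_of_norm_le_closedBall {F : V → W} (hF : Differentiable ℂ F) {c : V}
    {ρ M : ℝ} (hρ : 0 < ρ) (hM : ∀ y ∈ closedBall c (2 * ρ), ‖F y‖ ≤ M) {x y : V}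
    (hx : x ∈ closedBall c ρ) (hy : y ∈ closedBall c ρ) :
    ‖F x - F y‖ ≤ M / ρ * ‖x - y‖ := by
  refine Convex.norm_image_sub_le_of_norm_fderiv_le (𝕜 := ℂ) (s := closedBall c ρ)
    (fun z _ => hF z) (fun z hz => ?_) (convex_closedBall c ρ) hy hx
  refine norm_fderiv_le_of_norm_le_closedBall hF hρ fun w hw => hM w ?_
  exact closedBall_subset_closedBall' (by linarith [mem_closedBall.mp hz]) hw

theorem norm_fderiv_sub_le_of_norm_le_closedBall {F : V → W} (hF : Differentiable ℂ F) {c : V}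
    {ρ M : ℝ} (hρ : 0 < ρ) (hM : ∀ y ∈ closedBall c (4 * ρ), ‖F y‖ ≤ M) {x y : V}
    (hx : x ∈ closedBall c ρ) (hy : y ∈ closedBall c ρ) :
    ‖fderiv ℂ F x - fderiv ℂ F y‖ ≤ M / (2 * ρ ^ 2) * ‖x - y‖ := by
  have hG : Differentiable ℂ (fun z : V => F (z + x) - F (z + y)) := by fun_prop
  have h0 : fderiv ℂ (fun z : V => F (z + x) - F (z + y)) 0 = fderiv ℂ F x - fderiv ℂ F y := by
    rw [fderiv_fun_sub (by fun_prop) (by fun_prop), fderiv_comp_add_right, fderiv_comp_add_right]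
    simp
  rw [← h0]
  have := norm_fderiv_le_of_norm_le_closedBall hG (x := 0) (M := M / (2 * ρ) * ‖x - y‖) hρ
    fun z hz => ?_
  · calc _ ≤ _ := this
      _ = _ := by field_simp
  · rw [mem_closedBall, dist_eq_norm] at hz hx hy
    rw [sub_zero] at hz
    have := norm_sub_le_of_norm_le_closedBall hF (c := c) (ρ := 2 * ρ) (M := M) (by positivity)
      (by rwa [← mul_assoc, show (2 : ℝ) * 2 = 4 by norm_num]) (x := z + x) (y := z + y)
      (by
        rw [mem_closedBall, dist_eq_norm, add_sub_assoc]
        linarith [norm_add_le z (x - c)])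
      (by
        rw [mem_closedBall, dist_eq_norm, add_sub_assoc]
        linarith [norm_add_le z (y - c)])
    simpa using this

variable [FiniteDimensional ℂ V]

theorem continuous_fderiv_of_differentiable {F : V → W} (hF : Differentiable ℂ F) :
    Continuous (fderiv ℂ F) := by
  refine continuous_iff_continuousAt.mpr fun c => ?_
  obtain ⟨M, hM⟩ := exists_norm_le_closedBall hF.continuous c (4 * 1)
  refine continuousAt_of_locally_lipschitz (r := 1) one_pos (M / (2 * 1 ^ 2)) fun y hy => ?_
  rw [dist_eq_norm, dist_eq_norm]
  exact norm_fderiv_sub_le_of_norm_le_closedBall hF one_pos hM (ball_subset_closedBall hy)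
    (mem_closedBall_self zero_le_one)

theorem differentiable_fderiv_apply [CompleteSpace W] {F : V → W} (hF : Differentiable ℂ F)
    (v : V) : Differentiable ℂ (fun x => fderiv ℂ F x v) := by
  intro x₀
  have hcauchy : (fun x => fderiv ℂ F x v) = fun x => (2 * Real.pi * Complex.I : ℂ)⁻¹ •
      ∫ θ in (0 : ℝ)..2 * Real.pi, deriv (circleMap 0 1) θ •
        (((circleMap 0 1 θ - 0) ^ 2)⁻¹ • F (x + circleMap 0 1 θ • v)) := by
    funext x
    have hd : Differentiable ℂ (fun t : ℂ => F (x + t • v)) := by fun_prop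
    have := Complex.two_pi_I_inv_smul_circleIntegral_sub_sq_inv_smul_of_differentiable
      isOpen_univ (c := 0) (w₀ := 0) (R := 1) (subset_univ _) hd.differentiableOn
      (mem_ball_self one_pos)
    rw [(hasDerivAt_comp_add_smul (hF x) v).deriv] at this
    exact this.symm
  rw [hcauchy]
  refine DifferentiableAt.const_smul ?_ _
  have hcont := continuous_fderiv_of_differentiable hF
  have hk : Continuous fun θ : ℝ => deriv (circleMap 0 1) θ * ((circleMap 0 1 θ - 0) ^ 2)⁻¹ := by
    simp only [deriv_circleMap, sub_zero]
    refine Continuous.mul (by fun_prop) (Continuous.inv₀ (by fun_prop) fun θ => ?_)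
    exact pow_ne_zero _ (by simp [circleMap])
  simp only [smul_smul]
  obtain ⟨M, hM⟩ := exists_norm_le_closedBall hF.continuous x₀ (2 + ‖v‖)
  have hM0 : 0 ≤ M := (norm_nonneg _).trans (hM x₀ (mem_closedBall_self (by positivity)))
  have key := intervalIntegral.hasFDerivAt_integral_of_dominated_of_fderiv_le (𝕜 := ℂ)
    (μ := MeasureTheory.volume) (a := 0) (b := 2 * Real.pi) (x₀ := x₀) (s := ball x₀ 1)
    (F := fun x θ => (deriv (circleMap 0 1) θ * ((circleMap 0 1 θ - 0) ^ 2)⁻¹) •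
      F (x + circleMap 0 1 θ • v))
    (F' := fun x θ => (deriv (circleMap 0 1) θ * ((circleMap 0 1 θ - 0) ^ 2)⁻¹) •
      fderiv ℂ F (x + circleMap 0 1 θ • v))
    (bound := fun _ => M)
    (ball_mem_nhds _ one_pos)
    (Eventually.of_forall fun x => (hk.smul (hF.continuous.comp
      (by fun_prop))).aestronglyMeasurable)
    ((hk.smul (hF.continuous.comp (by fun_prop))).intervalIntegrable _ _)
    ((hk.smul (hcont.comp (by fun_prop))).aestronglyMeasurable)
    (MeasureTheory.ae_of_all _ fun θ _ x hx => ?_)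
    (by simp)
    (MeasureTheory.ae_of_all _ fun θ _ x _ => ?_)
  · exact key.differentiableAt
  · have h1 : ‖deriv (circleMap 0 1) θ * ((circleMap 0 1 θ - 0) ^ 2)⁻¹‖ = 1 := by
      simp [deriv_circleMap]
    rw [norm_smul, h1, one_mul]
    have := norm_fderiv_le_of_norm_le_closedBall hF (x := x + circleMap 0 1 θ • v) one_pos
      (M := M) fun y hy => hM y ?_
    · simpa using this
    · rw [mem_closedBall, dist_eq_norm] at hy ⊢
      rw [mem_ball, dist_eq_norm] at hx
      have h3 : ‖circleMap 0 1 θ • v‖ = ‖v‖ := by simp [norm_smul]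
      have : y - x₀ = (y - (x + circleMap 0 1 θ • v)) + (x - x₀) + circleMap 0 1 θ • v := by abel
      rw [this]
      refine (norm_add₃_le).trans ?_
      rw [h3]; linarith
  · refine HasFDerivAt.const_smul ?_ _
    have := (hF (x + circleMap 0 1 θ • v)).hasFDerivAt.comp x
      ((hasFDerivAt_id x).add_const (circleMap 0 1 θ • v))
    rw [ContinuousLinearMap.comp_id] at this
    exact this

theorem contDiff_of_differentiable [CompleteSpace W] (n : ℕ) {F : V → W}
    (hF : Differentiable ℂ F) : ContDiff ℂ n F := by
  induction n generalizing F with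
  | zero => exact_mod_cast contDiff_zero.mpr hF.continuous
  | succ n ih =>
    push_cast
    rw [contDiff_succ_iff_fderiv_apply]
    exact ⟨hF, fun h => by simp at h, fun v => ih (differentiable_fderiv_apply hF v)⟩

theorem differentiable_fderiv [CompleteSpace W] {F : V → W} (hF : Differentiable ℂ F) :
    Differentiable ℂ (fderiv ℂ F) :=
  ((contDiff_of_differentiable 2 hF).fderiv_right (m := 1) (by norm_num)).differentiable (by simp)

end SeveralVariables

/-! ### Discrete sets which are unavoidable for nondegenerate entire maps -/

section RosayRudin

open Metric Filter

theorem exists_tendsto_ultrafilter {V : Type*} [NormedAddCommGroup V] [ProperSpace V]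
    (U : Ultrafilter ℕ) {u : ℕ → V} {M : ℝ}
    (hu : ∀ᶠ m in U, ‖u m‖ ≤ M) : ∃ x, ‖x‖ ≤ M ∧ Tendsto u U (𝓝 x) := by
  obtain ⟨x, hx, hxU⟩ := (isCompact_closedBall (0 : V) M).ultrafilter_le_nhds' (U.map u)
    (Ultrafilter.mem_map.mpr (hu.mono fun m hm => by simpa using hm))
  exact ⟨x, by simpa using hx, hxU⟩

theorem isClosedDiscrete_of_finite_inter_closedBall {V : Type*} [NormedAddCommGroup V]
    {S : Set V}
    (hS : ∀ ρ, (S ∩ closedBall 0 ρ).Finite) : IsClosedDiscrete S := by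
  have key : ∀ z, ∃ U, IsOpen U ∧ z ∈ U ∧ S ∩ U ⊆ {z} := fun z => by
    refine ⟨ball 0 (‖z‖ + 1) ∩ ((S ∩ closedBall 0 (‖z‖ + 1)) \ {z})ᶜ,
      isOpen_ball.inter ((hS _).sdiff).isClosed.isOpen_compl, ⟨by simp, by simp⟩, ?_⟩
    rintro y ⟨hyS, hyb, hy⟩
    by_contra hne
    exact hy ⟨⟨hyS, ball_subset_closedBall hyb⟩, hne⟩
  constructor
  · rw [← isOpen_compl_iff, isOpen_iff_forall_mem_open]
    intro z hz
    obtain ⟨U, hU, hzU, hSU⟩ := key z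
    refine ⟨U, fun y hyU hyS => hz ?_, hU, hzU⟩
    rwa [← show y = z from hSU ⟨hyS, hyU⟩]
  · intro z hz
    obtain ⟨U, hU, hzU, hSU⟩ := key z
    exact ⟨U, hU, hzU, hSU.antisymm (singleton_subset_iff.mpr ⟨hz, hzU⟩)⟩

variable {V : Type*} [NormedAddCommGroup V] [NormedSpace ℂ V] [FiniteDimensional ℂ V]

theorem differentiable_det {D : ℂ → V →L[ℂ] V} (hD : Differentiable ℂ D) :
    Differentiable ℂ fun t => (D t).det := by
  let b := Module.finBasis ℂ V
  have h : ∀ t, (D t).det = (LinearMap.toMatrix b b (D t : V →ₗ[ℂ] V)).det :=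
    fun t => (LinearMap.det_toMatrix b _).symm
  simp only [h, Matrix.det_apply, LinearMap.toMatrix_apply]
  refine Differentiable.fun_sum fun σ _ => Differentiable.const_smul ?_ _
  refine Differentiable.fun_finsetProd fun i _ => ?_
  exact (LinearMap.toContinuousLinearMap (b.coord (σ i))).differentiable.comp
    (hD.clm_apply (differentiable_const (b i)))

/-- A uniformly bounded sequence of entire functions converges to a holomorphic function
along an ultrafilter. -/
theorem exists_tendsto_ultrafilter_differentiableOn (U : Ultrafilter ℕ) {T : Set ℂ} (hT : IsOpen T)
    {g : ℕ → ℂ → ℂ} (hg : ∀ m, Differentiable ℂ (g m)) {M : ℝ} (hM : ∀ m, ∀ t ∈ T, ‖g m t‖ ≤ M) :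
    ∃ G : ℂ → ℂ, DifferentiableOn ℂ G T ∧ ∀ t ∈ T, Tendsto (fun m => g m t) U (𝓝 (G t)) := by
  have hlim : ∀ t, ∃ z, t ∈ T → Tendsto (fun m => g m t) U (𝓝 z) := fun t => by
    by_cases ht : t ∈ T
    · obtain ⟨z, -, hz⟩ := exists_tendsto_ultrafilter U (.of_forall fun m => hM m t ht)
      exact ⟨z, fun _ => hz⟩
    · exact ⟨0, fun h => (ht h).elim⟩
  choose G hG using hlim
  refine ⟨G, ?_, hG⟩
  refine TendstoLocallyUniformlyOn.differentiableOn (F := g) (φ := (U : Filter ℕ)) ?_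
    (.of_forall fun m => (hg m).differentiableOn) hT
  rw [Metric.tendstoLocallyUniformlyOn_iff]
  intro ε hε t₀ ht₀
  obtain ⟨ρ, hρ, hρT⟩ := Metric.nhds_basis_closedBall.mem_iff.mp (hT.mem_nhds ht₀)
  have hM0 : 0 ≤ M := (norm_nonneg _).trans (hM 0 t₀ ht₀)
  have hlip : ∀ m, ∀ t ∈ closedBall t₀ (ρ / 2), ‖g m t - g m t₀‖ ≤ M / (ρ / 2) * ‖t - t₀‖ :=
    fun m t ht => norm_sub_le_of_norm_le_closedBall (hg m) (by positivity)
      (fun y hy => hM m y (hρT (by rwa [show 2 * (ρ / 2) = ρ by ring] at hy))) ht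
      (mem_closedBall_self (by positivity))
  have hsub : closedBall t₀ (ρ / 2) ⊆ T :=
    (closedBall_subset_closedBall (by linarith)).trans hρT
  have hlipG : ∀ t ∈ closedBall t₀ (ρ / 2), ‖G t - G t₀‖ ≤ M / (ρ / 2) * ‖t - t₀‖ :=
    fun t ht => le_of_tendsto ((hG t (hsub ht)).sub (hG t₀ ht₀)).norm
      (.of_forall fun m => hlip m t ht)
  have hnhds : ∀ᶠ t in 𝓝 t₀, M / (ρ / 2) * ‖t - t₀‖ < ε / 3 := by
    have : ContinuousAt (fun t : ℂ => M / (ρ / 2) * ‖t - t₀‖) t₀ := by fun_prop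
    exact this.eventually (gt_mem_nhds (by simpa using by positivity))
  refine ⟨_, mem_nhdsWithin_of_mem_nhds
    (inter_mem hnhds (closedBall_mem_nhds t₀ (half_pos hρ))), ?_⟩
  have hε3 : 0 < ε / 3 := by positivity
  filter_upwards [(Metric.tendsto_nhds.mp (hG t₀ ht₀)) _ hε3] with m hm t ht
  have h1 := hlip m t ht.2
  have h2 := hlipG t ht.2
  have h3 : M / (ρ / 2) * ‖t - t₀‖ < ε / 3 := ht.1
  rw [dist_eq_norm] at hm ⊢
  have : G t - g m t = (G t - G t₀) - (g m t₀ - G t₀) - (g m t - g m t₀) := by ring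
  rw [this]
  refine (norm_sub_le _ _).trans_lt ?_
  have := norm_sub_le (G t - G t₀) (g m t₀ - G t₀)
  linarith

/-- The quantitative inverse function theorem: the image of a map which is close to an invertible
linear map contains a ball of uniform size. -/
theorem exists_closedBall_subset_range {A : V →L[ℂ] V} (hA : A.det ≠ 0) {K ρ : ℝ} (hK : 0 ≤ K)
    (hρ : 0 < ρ) : ∃ δ > 0, ∃ η > 0, ∀ (F : V → V) (x : V), Differentiable ℂ F →
      (∀ z ∈ closedBall x ρ, ‖fderiv ℂ F z - fderiv ℂ F x‖ ≤ K * ‖z - x‖) →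
      ‖fderiv ℂ F x - A‖ ≤ δ → closedBall (F x) η ⊆ range F := by
  have := FiniteDimensional.complete ℂ V
  let e := A.toContinuousLinearEquivOfDetNeZero hA
  have he : ∀ v, A (e.symm v) = v := fun v => e.apply_symm_apply v
  let N : NNReal := ‖(e.symm : V →L[ℂ] V)‖₊ + 1
  have hN : 0 < N := by positivity
  let R : A.NonlinearRightInverse :=
    ⟨e.symm, N, fun y => ((e.symm : V →L[ℂ] V).le_opNorm y).trans (by
      gcongr; simp [N]), he⟩
  let c : NNReal := N⁻¹ / 2
  have hc : 0 < c := by positivity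
  let r : ℝ := min ρ (c / 2 / (K + 1))
  have hr : 0 < r := lt_min hρ (by positivity)
  refine ⟨c / 2, by positivity, c * r, by positivity, fun F x hF hlip hx => ?_⟩
  have happ : ApproximatesLinearOn F A (closedBall x r) c := by
    intro y hy z hz
    refine Convex.norm_image_sub_le_of_norm_fderiv_le' (𝕜 := ℂ) (s := closedBall x r)
      (fun w _ => hF w) (fun w hw => ?_) (convex_closedBall _ _) hz hy
    have h1 := hlip w (closedBall_subset_closedBall (min_le_left _ _) hw)
    have h2 : ‖w - x‖ ≤ c / 2 / (K + 1) := by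
      rw [← dist_eq_norm]; exact (mem_closedBall.mp hw).trans (min_le_right _ _)
    have h3 : K * ‖w - x‖ ≤ c / 2 := by
      rw [le_div_iff₀ (by positivity)] at h2
      nlinarith [norm_nonneg (w - x)]
    calc _ = ‖(fderiv ℂ F w - fderiv ℂ F x) + (fderiv ℂ F x - A)‖ := by congr 1; abel
      _ ≤ _ := (norm_add_le _ _).trans (by linarith)
  have hsurj := happ.surjOn_closedBall_of_nonlinearRightInverse R hr.le subset_rfl
  have heq : ((R.nnnorm : ℝ)⁻¹ - c) * r = c * r := by
    have : R.nnnorm = N := rfl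
    rw [this]; push_cast [c]; rw [sub_half]
  rw [heq] at hsurj
  exact fun y hy => image_subset_range _ _ (hsurj hy)

theorem exists_forall_mem_range {q : ℕ → V} (hq : DenseRange q) {a₁ a₂ r₀ r₁ r₂ : ℝ}
    (ha : 0 < a₁) (ha' : a₁ < a₂) (hr : r₀ < r₁) :
    ∃ m, ∀ F : V → V, Differentiable ℂ F → (∀ y ∈ closedBall 0 a₂, ‖F y‖ ≤ r₂) →
      (∃ x ∈ closedBall 0 a₁, r₁ ≤ ‖F x‖) → 1 ≤ ‖(fderiv ℂ F 0).det‖ →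
      ∃ i < m, r₀ < ‖q i‖ ∧ q i ∈ range F := by
  have := FiniteDimensional.proper ℂ V
  by_contra! hcon
  choose F hF hb hx hdet hmiss using hcon
  choose x hx hxr using hx
  let U := hyperfilter ℕ
  have hr₂ : 0 ≤ r₂ := (norm_nonneg _).trans (hb 0 0 (mem_closedBall_self (by linarith)))
  obtain ⟨x', hx', hxU⟩ := exists_tendsto_ultrafilter U (u := x) (M := a₁)
    (.of_forall fun m => by simpa using hx m)
  obtain ⟨a₃, h13, h32⟩ := exists_between ha'
  set L : ℝ := r₂ / (a₂ - a₃) with hL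
  have hL0 : 0 ≤ L := div_nonneg hr₂ (by linarith)
  have hfd : ∀ m, ∀ y ∈ closedBall (0 : V) a₃, ‖fderiv ℂ (F m) y‖ ≤ L := fun m y hy =>
    norm_fderiv_le_of_norm_le_closedBall (hF m) (by linarith) fun z hz => hb m z
      (closedBall_subset_closedBall' (by
        have : dist y 0 ≤ a₃ := hy
        linarith) hz)
  have hlip : ∀ m, ∀ y ∈ closedBall (0 : V) a₃, ∀ z ∈ closedBall (0 : V) a₃,
      ‖F m z - F m y‖ ≤ L * ‖z - y‖ := fun m y hy z hz =>
    Convex.norm_image_sub_le_of_norm_fderiv_le (𝕜 := ℂ) (s := closedBall 0 a₃)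
      (fun z _ => hF m z) (hfd m) (convex_closedBall _ _) hy hz
  obtain ⟨M, hM⟩ := (isCompact_closedBall (0 : V →L[ℂ] V) L).exists_bound_of_continuousOn
    (f := fun A => A.det) ContinuousLinearMap.continuous_det.continuousOn
  let T : Set ℂ := {t | ‖t • x'‖ < a₃}
  have hT : IsOpen T := isOpen_lt (by fun_prop) continuous_const
  have hTc : Convex ℝ T := by
    have : T = (fun t : ℂ => t • x') ⁻¹' ball 0 a₃ := by ext; simp [T]
    rw [this]
    exact (convex_ball (0 : V) a₃).linear_preimage
      ((LinearMap.toSpanSingleton ℂ V x').restrictScalars ℝ)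
  have hTb : ∀ t ∈ T, t • x' ∈ closedBall (0 : V) a₃ := fun t ht => by
    simpa using (le_of_lt ht : ‖t • x'‖ ≤ a₃)
  have h0T : (0 : ℂ) ∈ T := by simp only [T, mem_ofPred_eq, zero_smul, norm_zero]; linarith
  have h1T : (1 : ℂ) ∈ T := by simp only [T, mem_ofPred_eq, one_smul]; linarith
  obtain ⟨G, hG, hGU⟩ := exists_tendsto_ultrafilter_differentiableOn U hT
    (g := fun m t => (fderiv ℂ (F m) (t • x')).det)
    (fun m => differentiable_det ((differentiable_fderiv (hF m)).comp (by fun_prop)))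
    (M := M) (fun m t ht => hM _ (by simpa using hfd m _ (hTb t ht)))
  have hG0 : G 0 ≠ 0 := by
    have : 1 ≤ ‖G 0‖ := ge_of_tendsto (hGU 0 h0T).norm
      (.of_forall fun m => by simpa using hdet m)
    exact norm_pos_iff.mp (by linarith)
  have hGne : ∃ᶠ t in 𝓝 (1 : ℂ), G t ≠ 0 := by
    intro hev
    refine hG0 ((hG.analyticOnNhd hT).eqOn_zero_of_preconnected_of_eventuallyEq_zero
      hTc.isPreconnected h1T ?_ h0T)
    filter_upwards [hev] with t ht using not_not.mp ht
  set d := r₁ - r₀ with hd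
  have hd0 : 0 < d := by linarith
  have hnear : ∀ᶠ t in 𝓝 (1 : ℂ), L * ‖t • x' - x'‖ < d / 2 := by
    have : ContinuousAt (fun t : ℂ => L * ‖t • x' - x'‖) 1 := by fun_prop
    exact this.eventually (gt_mem_nhds (by simpa using by positivity))
  obtain ⟨t, hGt, htL, htT⟩ := (hGne.and_eventually (hnear.and (hT.mem_nhds h1T))).exists
  set p := t • x' with hp
  have hpb : p ∈ closedBall (0 : V) a₃ := hTb t htT
  obtain ⟨y, -, hyU⟩ := exists_tendsto_ultrafilter U (u := fun m => F m p) (M := r₂)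
    (.of_forall fun m => hb m p (closedBall_subset_closedBall h32.le hpb))
  obtain ⟨A, -, hAU⟩ := exists_tendsto_ultrafilter U (u := fun m => fderiv ℂ (F m) p) (M := L)
    (.of_forall fun m => hfd m p hpb)
  have hA : A.det ≠ 0 := by
    have := (ContinuousLinearMap.continuous_det.tendsto A).comp hAU
    rw [tendsto_nhds_unique this (hGU t htT)]
    exact hGt
  have hy : r₀ < ‖y‖ := by
    have hlow : r₁ - L * ‖p - x'‖ ≤ ‖y‖ := by
      have h1 : Tendsto (fun m => r₁ - L * ‖p - x m‖) U (𝓝 (r₁ - L * ‖p - x'‖)) :=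
        tendsto_const_nhds.sub (tendsto_const_nhds.mul (tendsto_const_nhds.sub hxU).norm)
      refine le_of_tendsto_of_tendsto h1 hyU.norm (.of_forall fun m => ?_)
      have h2 := hlip m p hpb (x m) (closedBall_subset_closedBall h13.le (hx m))
      rw [norm_sub_rev (x m)] at h2
      have h3 := norm_sub_norm_le (F m (x m)) (F m p)
      have h4 := hxr m
      simp only
      linarith
    linarith
  set ρ := (a₂ - a₃) / 4 with hρ
  have hρ0 : 0 < ρ := by simp only [hρ]; linarith
  obtain ⟨δ, hδ, η, hη, hball⟩ := exists_closedBall_subset_range hA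
    (K := r₂ / (2 * ρ ^ 2)) (by positivity) hρ0
  have hhit : ∀ᶠ m in (U : Filter ℕ), closedBall (F m p) η ⊆ range (F m) := by
    filter_upwards [Metric.tendsto_nhds.mp hAU δ hδ] with m hm
    refine hball (F m) p (hF m) (fun z hz => ?_) (by rw [← dist_eq_norm]; exact hm.le)
    refine norm_fderiv_sub_le_of_norm_le_closedBall (hF m) hρ0 (fun w hw => hb m w ?_) hz
      (mem_closedBall_self hρ0.le)
    refine closedBall_subset_closedBall' ?_ hw
    have : dist p 0 ≤ a₃ := hpb
    simp only [hρ]; linarith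
  obtain ⟨i, hi⟩ := hq.exists_dist_lt y (ε := min (η / 2) (‖y‖ - r₀))
    (lt_min (by positivity) (by linarith))
  rw [lt_min_iff, dist_eq_norm] at hi
  obtain ⟨m, hm1, hm2, hm3⟩ := (hhit.and ((Metric.tendsto_nhds.mp hyU (η / 2) (by positivity)).and
    (Nat.hyperfilter_le_atTop (eventually_gt_atTop i)))).exists
  refine hmiss m i hm3 ?_ (hm1 ?_)
  · have := norm_sub_norm_le y (q i)
    linarith
  · rw [mem_closedBall, dist_comm]
    rw [← dist_eq_norm] at hi
    exact (dist_triangle _ y _).trans (by linarith)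



/-- **Rosay–Rudin**: the complement of a suitable discrete set is volume hyperbolic. Moreover,
the discrete set can be chosen outside of any set with dense complement. -/
theorem exists_unavoidable_set [Nontrivial V] {Z : Set V} (hZ : Dense Zᶜ) {R : ℝ} (hR : 0 ≤ R) :
    ∃ S : Set V, (∀ ρ, (S ∩ closedBall 0 ρ).Finite) ∧ Disjoint S Z ∧ (∀ s ∈ S, R < ‖s‖) ∧
      ∀ F : V → V, Differentiable ℂ F → (∀ x, F x ∉ S) → ∀ x, (fderiv ℂ F x).det = 0 := by
  have := FiniteDimensional.proper ℂ V
  obtain ⟨Q, hQZ, hQc, hQd⟩ := hZ.exists_countable_dense_subset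
  obtain ⟨q, rfl⟩ := hQc.exists_eq_range hQd.nonempty
  let a : ℕ → ℝ := fun j => 2 - 1 / (j + 1)
  let r : ℕ → ℝ := fun j => R + j + 1
  have ha0 : ∀ j, 0 < a j := fun j => by
    have : (1 : ℝ) / (j + 1) ≤ 1 := by
      rw [div_le_one (by positivity)]; linarith [(Nat.cast_nonneg j : (0 : ℝ) ≤ j)]
    simp only [a]; linarith
  have ha2 : ∀ j, a j ≤ 2 := fun j => by
    have : (0 : ℝ) ≤ 1 / (j + 1) := by positivity
    simp only [a]; linarith
  have haa : ∀ j, a j < a (j + 1) := fun j => by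
    have : (1 : ℝ) / ((j + 1 : ℕ) + 1) < 1 / (j + 1) := by
      gcongr; linarith [show ((j + 1 : ℕ) : ℝ) = j + 1 by push_cast; ring]
    simp only [a]; linarith
  choose m hm using fun j => exists_forall_mem_range (V := V) hQd (ha0 j) (haa j)
    (show r j - 1 / 2 < r j by linarith) (r₂ := r (j + 1))
  refine ⟨{s | ∃ j, ∃ i < m j, q i = s ∧ r j - 1 / 2 < ‖s‖}, fun ρ => ?_, ?_, ?_, ?_⟩
  · refine ((finite_lt_nat ⌈ρ⌉₊).biUnion fun j _ => (finite_lt_nat (m j)).image q).subset ?_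
    rintro s ⟨⟨j, i, hi, rfl, hs⟩, hsρ⟩
    refine mem_biUnion (x := j) ?_ ⟨i, hi, rfl⟩
    have : ‖q i‖ ≤ ρ := by simpa using hsρ
    simp only [r] at hs
    exact_mod_cast (show (j : ℝ) < ρ by linarith).trans_le (Nat.le_ceil ρ)
  · refine Set.disjoint_left.mpr ?_
    rintro s ⟨j, i, hi, rfl, hs⟩
    exact hQZ (mem_range_self i)
  · rintro s ⟨j, i, hi, rfl, hs⟩
    simp only [r] at hs
    linarith [(Nat.cast_nonneg j : (0 : ℝ) ≤ j)]
  intro F hF hFS x₀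
  by_contra hdet
  have hn : Module.finrank ℂ V ≠ 0 := Module.finrank_pos.ne'
  obtain ⟨y, hy⟩ : ∃ y, r 0 < ‖F y‖ := by
    by_contra! hbd
    have hconst : F = fun _ => F x₀ := funext fun z =>
      hF.apply_eq_apply_of_bounded (isBounded_iff_forall_norm_le.mpr
        ⟨r 0, by rintro _ ⟨w, rfl⟩; exact hbd w⟩) z x₀
    refine hdet ?_
    rw [hconst]
    simp [ContinuousLinearMap.det]
  let l : ℝ := max 1 (max ‖y - x₀‖ ‖(fderiv ℂ F x₀).det‖⁻¹)
  have hl1 : 1 ≤ l := le_max_left _ _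
  have hl2 : ‖y - x₀‖ ≤ l := (le_max_left _ _).trans (le_max_right _ _)
  have hl3 : ‖(fderiv ℂ F x₀).det‖⁻¹ ≤ l := (le_max_right _ _).trans (le_max_right _ _)
  have hl0 : l ≠ 0 := by positivity
  let H : V → V := fun z => F (x₀ + (l : ℂ) • z)
  have hH : Differentiable ℂ H := by fun_prop
  have hHd : 1 ≤ ‖(fderiv ℂ H 0).det‖ := by
    have h1 : HasFDerivAt F (fderiv ℂ F x₀) (x₀ + (l : ℂ) • (0 : V)) := by
      simpa using (hF x₀).hasFDerivAt
    have h2 : HasFDerivAt (fun z : V => x₀ + (l : ℂ) • z)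
      ((l : ℂ) • ContinuousLinearMap.id ℂ V) 0 :=
      ((hasFDerivAt_id (0 : V)).const_smul (l : ℂ)).const_add x₀
    have h3 : fderiv ℂ H 0 = (l : ℂ) • fderiv ℂ F x₀ := by
      have : HasFDerivAt H _ 0 := h1.comp 0 h2
      rw [this.fderiv, ContinuousLinearMap.comp_smul, ContinuousLinearMap.comp_id]
    have h4 : (fderiv ℂ H 0).det = (l : ℂ) ^ Module.finrank ℂ V * (fderiv ℂ F x₀).det := by
      rw [h3]; exact LinearMap.det_smul _ _
    have h5 : l ≤ l ^ Module.finrank ℂ V := le_self_pow₀ hl1 hn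
    have h6 : 0 < ‖(fderiv ℂ F x₀).det‖ := norm_pos_iff.mpr hdet
    rw [h4, norm_mul, norm_pow, Complex.norm_real, Real.norm_of_nonneg (by positivity)]
    rw [inv_le_iff_one_le_mul₀ h6] at hl3
    nlinarith
  let P : ℕ → Prop := fun j => ∀ z ∈ closedBall (0 : V) (a j), ‖H z‖ ≤ r j
  have hP : ∃ j, P j := by
    obtain ⟨M, hM⟩ := exists_norm_le_closedBall hH.continuous 0 2
    obtain ⟨j, hj⟩ := exists_nat_ge M
    refine ⟨j, fun z hz => (hM z (closedBall_subset_closedBall (ha2 j) hz)).trans ?_⟩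
    simp only [r]; linarith
  have hP0 : ¬ P 0 := fun h => by
    have := h (((l : ℂ))⁻¹ • (y - x₀)) (by
      have : ‖(l : ℂ)‖ = l := by
        rw [Complex.norm_real, Real.norm_of_nonneg (by positivity)]
      rw [mem_closedBall_zero_iff, norm_smul, norm_inv, this, inv_mul_le_iff₀ (by positivity)]
      simp only [a]; norm_num; exact hl2)
    have hc : (l : ℂ) ≠ 0 := by exact_mod_cast hl0
    simp only [H, smul_smul, mul_inv_cancel₀ hc, one_smul, add_sub_cancel] at this
    linarith
  classical
  obtain ⟨k, hk⟩ : ∃ k, Nat.find hP = k + 1 :=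
    Nat.exists_eq_succ_of_ne_zero fun h => hP0 (h ▸ Nat.find_spec hP)
  have hk1 : P (k + 1) := hk ▸ Nat.find_spec hP
  have hk2 : ¬ P k := Nat.find_min hP (by omega)
  simp only [P] at hk2
  push Not at hk2
  obtain ⟨z, hz, hzr⟩ := hk2
  obtain ⟨i, hi, hir, w, hw⟩ := hm k H hH hk1 ⟨z, hz, hzr.le⟩ hHd
  exact hFS _ ⟨k, i, hi, hw.symm, by rw [show F (x₀ + (l : ℂ) • w) = q i from hw]; exact hir⟩

end RosayRudin

/-! ### A proper holomorphic embedding of the disc by lacunary series -/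

section Disc

open Metric Filter

/-- A lacunary power series which is large on a sequence of annuli exhausting the unit disc. -/
theorem exists_lacunary_series {ρ : ℕ → ℝ} (hρ : StrictMono ρ) (hρ0 : 0 < ρ 0)
    (hρ1 : ∀ j, ρ j < 1) (hρl : Tendsto ρ atTop (𝓝 1)) :
    ∃ f : ℂ → ℂ, DifferentiableOn ℂ f (ball 0 1) ∧
      ∀ (k : ℕ) (z : ℂ), ρ (2 * k + 1) ≤ ‖z‖ → ‖z‖ ≤ ρ (2 * k + 2) → k ≤ ‖f z‖ := by
  have hpos : ∀ j, 0 < ρ j := fun j => hρ0.trans_le (hρ.monotone (Nat.zero_le j))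
  have hmid : ∀ k, ∃ σ, ρ (2 * k) < σ ∧ σ < ρ (2 * k + 1) := fun k =>
    exists_between (hρ (Nat.lt_succ_self _))
  choose σ hσ1 hσ2 using hmid
  have hσ0 : ∀ k, 0 < σ k := fun k => (hpos _).trans (hσ1 k)
  have hstep : ∀ (k : ℕ) (B : ℝ), ∃ n : ℕ, (ρ (2 * k) / σ k) ^ n ≤ (1 / 2) ^ k ∧
      k + B + 2 ≤ (ρ (2 * k + 1) / σ k) ^ n := fun k B => by
    have h1 := tendsto_pow_atTop_nhds_zero_of_lt_one (div_pos (hpos (2 * k)) (hσ0 k)).le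
      ((div_lt_one (hσ0 k)).mpr (hσ1 k))
    have h2 := tendsto_pow_atTop_atTop_of_one_lt ((one_lt_div (hσ0 k)).mpr (hσ2 k))
    exact ((h1.eventually (ge_mem_nhds (show (0 : ℝ) < (1 / 2) ^ k by positivity))).and
      (h2.eventually_ge_atTop _)).exists
  choose N hN1 hN2 using hstep
  let B : ℕ → ℝ := fun k => Nat.rec 0 (fun k b => b + (1 / σ k) ^ N k b) k
  let n : ℕ → ℕ := fun k => N k (B k)
  have hB : ∀ k, B k = ∑ i ∈ Finset.range k, (1 / σ i) ^ n i := fun k => by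
    induction k with
    | zero => rfl
    | succ k ih => rw [Finset.sum_range_succ, ← ih]
  let u : ℕ → ℂ → ℂ := fun k z => (z / σ k) ^ n k
  have hu : ∀ k z, ‖u k z‖ = (‖z‖ / σ k) ^ n k := fun k z => by
    simp only [u, norm_pow, norm_div, Complex.norm_real, Real.norm_of_nonneg (hσ0 k).le]
  have hu1 : ∀ k z, ‖z‖ ≤ 1 → ‖u k z‖ ≤ (1 / σ k) ^ n k := fun k z hz => by
    rw [hu]
    have := hσ0 k
    gcongr
  have hu2 : ∀ k j z, j < k → ‖z‖ ≤ ρ (2 * j + 2) → ‖u k z‖ ≤ (1 / 2) ^ k := fun k j z hjk hz => by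
    refine le_trans ?_ (hN1 k (B k))
    rw [hu]
    have := hσ0 k
    have : ‖z‖ ≤ ρ (2 * k) := hz.trans (hρ.monotone (by omega))
    gcongr
  let b : ℕ → ℕ → ℝ := fun j k => (1 / 2) ^ k + if k < j + 1 then (1 / σ k) ^ n k else 0
  have hgeo : Summable fun k : ℕ => ((1 : ℝ) / 2) ^ k := summable_geometric_two
  have hb : ∀ j, Summable (b j) := fun j => hgeo.add
    (summable_of_ne_finset_zero (s := Finset.range (j + 1)) fun k hk => if_neg (by simpa using hk))
  have hub : ∀ j k z, ‖z‖ ≤ ρ (2 * j + 2) → ‖u k z‖ ≤ b j k := fun j k z hz => by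
    simp only [b]
    split_ifs with h
    · exact (hu1 k z (hz.trans (hρ1 _).le)).trans (by simp)
    · rw [add_zero]; exact hu2 k j z (by omega) hz
  refine ⟨fun z => ∑' k, u k z, fun z hz => ?_, fun k z hz1 hz2 => ?_⟩
  · have hz' : ‖z‖ < 1 := by simpa using hz
    have htend : Tendsto (fun j => ρ (2 * j + 2)) atTop (𝓝 1) :=
      hρl.comp (tendsto_atTop_mono (fun j => by simp only [id]; omega) tendsto_id)
    obtain ⟨j, hj⟩ := (htend.eventually (lt_mem_nhds hz')).exists
    have hd := Complex.differentiableOn_tsum_of_summable_norm (hb j)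
      (F := u) (U := ball 0 (ρ (2 * j + 2))) (fun k => by fun_prop) isOpen_ball
      (fun k w hw => hub j k w (by simpa using (mem_ball.mp hw).le))
    exact ((hd z (by simpa using hj)).differentiableAt
      (isOpen_ball.mem_nhds (by simpa using hj))).differentiableWithinAt
  · have hs : Summable fun i => u i z := .of_norm_bounded (hb k) fun i => hub k i z hz2
    have hk : k + B k + 2 ≤ ‖u k z‖ := by
      refine (hN2 k (B k)).trans ?_
      rw [hu]
      have := hσ0 k
      have := hpos (2 * k + 1)
      gcongr
    have hlow : ‖∑ i ∈ Finset.range k, u i z‖ ≤ B k := by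
      rw [hB]
      exact norm_sum_le_of_le _ fun i _ => hu1 i z (hz2.trans (hρ1 _).le)
    have htail : ‖∑' i, u (i + (k + 1)) z‖ ≤ 2 := by
      refine (tsum_of_norm_bounded (g := fun i => (1 / 2 : ℝ) ^ i) (a := 2) ?_ fun i => ?_)
      · exact hasSum_geometric_two
      · refine (hu2 _ k z (by omega) hz2).trans ?_
        exact pow_le_pow_of_le_one (by norm_num) (by norm_num) (by omega)
    have hsum : ∑' i, u i z =
        (∑ i ∈ Finset.range k, u i z) + u k z + ∑' i, u (i + (k + 1)) z := by
      rw [← hs.sum_add_tsum_nat_add (k + 1), Finset.sum_range_succ]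
    have : u k z = (∑' i, u i z) - (∑ i ∈ Finset.range k, u i z) - ∑' i, u (i + (k + 1)) z := by
      rw [hsum]; ring
    have h1 := norm_sub_le ((∑' i, u i z) - (∑ i ∈ Finset.range k, u i z))
      (∑' i, u (i + (k + 1)) z)
    have h2 := norm_sub_le (∑' i, u i z) (∑ i ∈ Finset.range k, u i z)
    rw [← this] at h1
    simp only
    linarith

theorem exists_proper_pair_on_disc :
    ∃ φ : Fin 2 → ℂ → ℂ, (∀ b, DifferentiableOn ℂ (φ b) (ball 0 1)) ∧
    ∀ M : ℝ, ∃ r < 1, ∀ z : ℂ, r ≤ ‖z‖ → ‖z‖ < 1 → ∃ b, M ≤ ‖φ b z‖ := by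
  let ρ : ℕ → ℝ := fun j => 1 - 1 / (j + 2)
  have hρ : StrictMono ρ := strictMono_nat_of_lt_succ fun j => by
    have : (1 : ℝ) / ((j + 1 : ℕ) + 2) < 1 / (j + 2) := by
      gcongr; linarith [show ((j + 1 : ℕ) : ℝ) = j + 1 by push_cast; ring]
    simp only [ρ]; linarith
  have hρ0 : 0 < ρ 0 := by norm_num [ρ]
  have hρ1 : ∀ j, ρ j < 1 := fun j => by
    have : (0 : ℝ) < 1 / (j + 2) := by positivity
    simp only [ρ]; linarith
  have hρl : Tendsto ρ atTop (𝓝 1) := by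
    have h := (tendsto_one_div_add_atTop_nhds_zero_nat (𝕜 := ℝ)).comp (tendsto_add_atTop_nat 1)
    have := (tendsto_const_nhds (x := (1 : ℝ))).sub h
    rw [sub_zero] at this
    refine this.congr fun j => ?_
    simp only [ρ, Function.comp]
    push_cast
    rw [add_assoc]; norm_num
  obtain ⟨f, hf, hfk⟩ := exists_lacunary_series hρ hρ0 hρ1 hρl
  obtain ⟨g, hg, hgk⟩ := exists_lacunary_series (ρ := fun j => ρ (j + 1))
    (hρ.comp (strictMono_id.add_const 1)) (hρ0.trans (hρ (by simp))) (fun j => hρ1 _)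
    (hρl.comp (tendsto_add_atTop_nat 1))
  refine ⟨![f, g], Fin.forall_fin_two.mpr ⟨hf, hg⟩, fun M => ?_⟩
  obtain ⟨K, hK⟩ := exists_nat_ge M
  refine ⟨ρ (2 * K + 3), hρ1 _, fun z hz1 hz2 => ?_⟩
  have hex : ∃ j, ‖z‖ ≤ ρ j := ((hρl.eventually (lt_mem_nhds hz2)).exists).imp fun _ h => h.le
  classical
  have hz3 := Nat.find_spec hex
  have hj : 2 * K + 3 ≤ Nat.find hex := by
    by_contra hlt
    exact absurd (hρ (not_le.mp hlt)) (not_lt.mpr (hz1.trans hz3))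
  obtain ⟨j, hj'⟩ : ∃ j, Nat.find hex = j + 1 := ⟨Nat.find hex - 1, by omega⟩
  have hz4 : ρ j < ‖z‖ := not_le.mp (Nat.find_min hex (by omega))
  rw [hj'] at hz3
  rcases Nat.even_or_odd' (j + 1) with ⟨k, hk | hk⟩
  · refine ⟨0, (hK.trans ?_).trans (hfk (k - 1) z ?_ ?_)⟩
    · exact_mod_cast (show K ≤ k - 1 by omega)
    · rw [show 2 * (k - 1) + 1 = j by omega]; exact hz4.le
    · rw [show 2 * (k - 1) + 2 = j + 1 by omega]; exact hz3
  · refine ⟨1, (hK.trans ?_).trans (hgk (k - 1) z ?_ ?_)⟩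
    · exact_mod_cast (show K ≤ k - 1 by omega)
    · rw [show 2 * (k - 1) + 1 + 1 = j by omega]; exact hz4.le
    · rw [show 2 * (k - 1) + 2 + 1 = j + 1 by omega]; exact hz3

theorem isClosed_graph_on_disc {φ : Fin 2 → ℂ → ℂ} (hφ : ∀ b, DifferentiableOn ℂ (φ b) (ball 0 1))
    (hφM : ∀ M : ℝ, ∃ r < 1, ∀ z : ℂ, r ≤ ‖z‖ → ‖z‖ < 1 → ∃ b, M ≤ ‖φ b z‖) :
    IsClosed {p : ℂ × (Fin 2 → ℂ) | ‖p.1‖ < 1 ∧ ∀ b, p.2 b = φ b p.1} := by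
  refine isClosed_of_closure_subset fun p hp => ?_
  rw [mem_closure_iff_nhdsWithin_neBot] at hp
  obtain ⟨r, hr, hrM⟩ := hφM (‖p.2‖ + 1)
  set Γ := {p : ℂ × (Fin 2 → ℂ) | ‖p.1‖ < 1 ∧ ∀ b, p.2 b = φ b p.1} with hΓ
  have hnear : ∀ᶠ y in 𝓝 p, ‖y.2‖ < ‖p.2‖ + 1 :=
    (continuous_snd.norm.continuousAt).eventually (gt_mem_nhds (by simp))
  have hle : ‖p.1‖ ≤ r := by
    refine le_of_tendsto (x := 𝓝[Γ] p)
      ((continuous_fst.norm.tendsto p).mono_left nhdsWithin_le_nhds) ?_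
    filter_upwards [self_mem_nhdsWithin, nhdsWithin_le_nhds hnear] with y hy hy2
    by_contra! hlt
    obtain ⟨b, hb⟩ := hrM y.1 hlt.le hy.1
    rw [← hy.2 b] at hb
    linarith [norm_le_pi_norm y.2 b]
  refine ⟨hle.trans_lt hr, fun b => ?_⟩
  have hc : ContinuousAt (φ b) p.1 := ((hφ b).differentiableAt (isOpen_ball.mem_nhds
    (by simpa using hle.trans_lt hr))).continuousAt
  refine tendsto_nhds_unique_of_eventuallyEq (l := 𝓝[Γ] p) (f := fun y => y.2 b)
    (g := fun y => φ b y.1) ?_ ?_ ?_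
  · exact (((continuous_apply b).comp continuous_snd).tendsto p).mono_left nhdsWithin_le_nhds
  · exact (hc.tendsto.comp (continuous_fst.tendsto p)).mono_left nhdsWithin_le_nhds
  · filter_upwards [self_mem_nhdsWithin] with y hy using hy.2 b

end Disc

/-! ### Open subsets of normed spaces as complex manifolds -/

section Opens

variable {E E' : Type*} [NormedAddCommGroup E] [NormedSpace ℂ E]
  [NormedAddCommGroup E'] [NormedSpace ℂ E'] {U : Opens E}

theorem mdifferentiableAt_comp_val_iff {g : E → E'} {x : U} :
    MDifferentiableAt 𝓘(ℂ, E) 𝓘(ℂ, E') (fun y : U => g y) x ↔ DifferentiableAt ℂ g x := by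
  rw [← mdifferentiableAt_iff_differentiableAt]
  exact ((differentiableWithinAt_localInvariantProp
    (I := 𝓘(ℂ, E)) (I' := 𝓘(ℂ, E'))).liftPropAt_iff_comp_subtype_val g x).symm

theorem hasMFDerivAt_comp_val {g : E → E'} {x : U} {g' : E →L[ℂ] E'} (hg : HasFDerivAt g g' x) :
    HasMFDerivAt 𝓘(ℂ, E) 𝓘(ℂ, E') (fun y : U => g y) x g' := by
  refine ⟨(hg.continuousAt.comp continuous_subtype_val.continuousAt : _), ?_⟩
  have h := TopologicalSpace.Opens.chartAt_subtype_val_symm_eventuallyEq (H := E) U (x := x)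
  have h' : HasFDerivAt (fun z : E => g ((chartAt E x).symm z)) g' x := by
    refine hg.congr_of_eventuallyEq ?_
    have hx : (chartAt E (x : E)) x = x := rfl
    rw [hx] at h
    filter_upwards [h] with z hz
    exact (congrArg g hz).symm
  exact h'.hasFDerivWithinAt

theorem isSteinManifold_of_isClosedEmbedding {N : ℕ} {g : E → Fin N → ℂ}
    (hg : ∀ x ∈ U, DifferentiableAt ℂ g x) (hcl : IsClosedEmbedding fun x : U => g x)
    (hinj : ∀ x ∈ U, Injective (fderiv ℂ g x)) : IsSteinManifold E U := by
  refine ⟨N, fun x => g x, fun x => mdifferentiableAt_comp_val_iff.mpr (hg x x.2), hcl, fun x => ?_⟩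
  rw [(hasMFDerivAt_comp_val (hg x x.2).hasFDerivAt).mfderiv]
  exact hinj x x.2

theorem isClosedComplexSubmanifold_of_submersion {A : Set U} (hA : IsClosed A) {W : Set E}
    (hW : IsOpen W) (hAW : ∀ x ∈ A, (x : E) ∈ W) {n : ℕ} {g : E → Fin n → ℂ}
    (hg : ∀ x ∈ W, DifferentiableAt ℂ g x) (hsurj : ∀ x ∈ W, Surjective (fderiv ℂ g x))
    (hAg : ∀ x : U, (x : E) ∈ W → (x ∈ A ↔ g x = 0)) : IsClosedComplexSubmanifold E A := by
  have hW' : IsOpen (Subtype.val ⁻¹' W : Set U) := hW.preimage continuous_subtype_val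
  refine ⟨hA, fun x hx => ⟨_, hW', hAW x hx, n, fun y => g y, fun y hy =>
    (mdifferentiableAt_comp_val_iff.mpr (hg y hy)).mdifferentiableWithinAt, fun y hy => ?_, ?_⟩⟩
  · rw [mfderivWithin_of_isOpen hW' hy, (hasMFDerivAt_comp_val (hg y hy).hasFDerivAt).mfderiv]
    exact hsurj y hy
  · ext y
    exact ⟨fun h => ⟨h.2, (hAg y h.2).mp h.1⟩, fun h => ⟨(hAg y h.1).mpr h.2, h.1⟩⟩

/-- A holomorphic map on an open subset extends to a map of the ambient space. -/
theorem exists_extension_of_holomorphic {f : U → E'} (hf : Holomorphic E E' f) :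
    ∃ g : E → E', (∀ x : U, g x = f x) ∧ ∀ x ∈ U, DifferentiableAt ℂ g x := by
  classical
  let g : E → E' := fun x => if h : x ∈ U then f ⟨x, h⟩ else 0
  have hgf : (fun x : U => g x) = f := by
    ext x; simp [g]
  refine ⟨g, fun x => congrFun hgf x, fun x hx => ?_⟩
  have := hf ⟨x, hx⟩
  rw [← hgf] at this
  exact mdifferentiableAt_comp_val_iff.mp this

end Opens

/-! ### Failure of the extension theorem in every dimension -/

section HigherDimension

open Metric Filter

variable {n : ℕ}

/-- The map `ℂⁿ → ℂ³ⁿ` acting by `z ↦ (ψ₀ z, ψ₁ z, ψ₂ z)` on each coordinate. -/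
def tripleMap (ψ : Fin 3 → ℂ → ℂ) (z : Fin n → ℂ) : Fin (3 * n) → ℂ :=
  fun j => ψ (finProdFinEquiv.symm j).1 (z (finProdFinEquiv.symm j).2)

theorem differentiableAt_tripleMap {ψ : Fin 3 → ℂ → ℂ} {z : Fin n → ℂ}
    (hψ : ∀ k i, DifferentiableAt ℂ (ψ k) (z i)) : DifferentiableAt ℂ (tripleMap ψ) z := by
  refine differentiableAt_pi.mpr fun j => ?_
  exact (hψ _ _).comp z (differentiableAt_apply _ _)

/-- The points `(z, w, w')` of `ℂ³ⁿ` with `z` in the unit polydisc and `wᵢ = φ₀ zᵢ`,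
`w'ᵢ = φ₁ zᵢ`. -/
def polydiscGraph (n : ℕ) (φ : Fin 2 → ℂ → ℂ) : Set (Fin (3 * n) → ℂ) :=
  {x | ∀ i : Fin n, ‖x (finProdFinEquiv (0, i))‖ < 1 ∧
    ∀ b : Fin 2, x (finProdFinEquiv (b.succ, i)) = φ b (x (finProdFinEquiv (0, i)))}

theorem tripleMap_mem_polydiscGraph {φ : Fin 2 → ℂ → ℂ} {z : Fin n → ℂ} (hz : ∀ i, ‖z i‖ < 1) :
    tripleMap (Fin.cons id φ) z ∈ polydiscGraph n φ := by
  intro i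
  simp [tripleMap, hz i]

theorem isClosed_polydiscGraph {φ : Fin 2 → ℂ → ℂ}
    (hφ : ∀ b, DifferentiableOn ℂ (φ b) (ball 0 1))
    (hφM : ∀ M : ℝ, ∃ r < 1, ∀ z : ℂ, r ≤ ‖z‖ → ‖z‖ < 1 → ∃ b, M ≤ ‖φ b z‖) :
    IsClosed (polydiscGraph n φ) := by
  have : polydiscGraph n φ = ⋂ i : Fin n, (fun x : Fin (3 * n) → ℂ =>
      (x (finProdFinEquiv (0, i)), fun b : Fin 2 => x (finProdFinEquiv (b.succ, i)))) ⁻¹'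
      {p : ℂ × (Fin 2 → ℂ) | ‖p.1‖ < 1 ∧ ∀ b, p.2 b = φ b p.1} := by
    ext x; simp [polydiscGraph]
  rw [this]
  exact isClosed_iInter fun i => (isClosed_graph_on_disc hφ hφM).preimage (by fun_prop)

theorem isClosedComplexSubmanifold_polydiscGraph {φ : Fin 2 → ℂ → ℂ}
    (hφ : ∀ b, DifferentiableOn ℂ (φ b) (ball 0 1))
    (hφM : ∀ M : ℝ, ∃ r < 1, ∀ z : ℂ, r ≤ ‖z‖ → ‖z‖ < 1 → ∃ b, M ≤ ‖φ b z‖) :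
    IsClosedComplexSubmanifold (Fin (3 * n) → ℂ)
      {x : (⊤ : Opens (Fin (3 * n) → ℂ)) | (x : Fin (3 * n) → ℂ) ∈ polydiscGraph n φ} := by
  let g : (Fin (3 * n) → ℂ) → Fin (2 * n) → ℂ := fun x j =>
    x (finProdFinEquiv ((finProdFinEquiv.symm j).1.succ, (finProdFinEquiv.symm j).2)) -
      φ (finProdFinEquiv.symm j).1 (x (finProdFinEquiv (0, (finProdFinEquiv.symm j).2)))
  let W : Set (Fin (3 * n) → ℂ) := {x | ∀ i : Fin n, ‖x (finProdFinEquiv (0, i))‖ < 1}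
  have hW : IsOpen W := by
    simp only [W, ofPred_forall]
    exact isOpen_iInter_of_finite fun i => isOpen_lt (by fun_prop) continuous_const
  have hg : ∀ x ∈ W, DifferentiableAt ℂ g x := fun x hx => by
    refine differentiableAt_pi.mpr fun j => DifferentiableAt.fun_sub (by fun_prop) ?_
    refine DifferentiableAt.comp x (g := φ _) ?_ (by fun_prop)
    exact (hφ _).differentiableAt (isOpen_ball.mem_nhds (by simpa using hx _))
  refine isClosedComplexSubmanifold_of_submersion (W := W) (g := g)
    ((isClosed_polydiscGraph hφ hφM).preimage continuous_subtype_val) hW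
    (fun x hx i => (hx i).1) hg (fun x hx y => ?_) (fun x hx => ?_)
  · let v : Fin (3 * n) → ℂ := fun j =>
      (Fin.cons 0 (fun (b : Fin 2) (i : Fin n) => y (finProdFinEquiv (b, i))) :
        Fin 3 → Fin n → ℂ) (finProdFinEquiv.symm j).1 (finProdFinEquiv.symm j).2
    refine ⟨v, (hasDerivAt_comp_add_smul (hg x hx) v).unique ?_⟩
    have hv : (fun t : ℂ => g (x + t • v)) = fun t : ℂ => g x + t • y := by
      ext t j
      obtain ⟨⟨b, i⟩, rfl⟩ := finProdFinEquiv.surjective j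
      simp only [g, v, Equiv.symm_apply_apply, Pi.add_apply, Pi.smul_apply, Fin.cons_succ,
        Fin.cons_zero, Pi.zero_apply, mul_zero, add_zero, smul_eq_mul]
      ring
    rw [hv]
    simpa using ((hasDerivAt_id (0 : ℂ)).smul_const y).const_add (g x)
  · constructor
    · intro h
      ext j
      exact sub_eq_zero.mpr ((h (finProdFinEquiv.symm j).2).2 (finProdFinEquiv.symm j).1)
    · intro h i
      refine ⟨hx i, fun b => ?_⟩
      have := congrFun h (finProdFinEquiv (b, i))
      simpa only [g, Equiv.symm_apply_apply, Pi.zero_apply, sub_eq_zero] using this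

theorem isSteinManifold_top (N : ℕ) :
    IsSteinManifold (Fin N → ℂ) (⊤ : Opens (Fin N → ℂ)) :=
  isSteinManifold_of_isClosedEmbedding (g := id) (fun _ _ => differentiableAt_id)
    (isClosed_univ.isClosedEmbedding_subtypeVal) (fun x _ => by simpa using injective_id)

/-- No entire map `ℂ³ⁿ → ℂⁿ` which is the coordinate projection on the graph can avoid a
Rosay–Rudin set. -/
theorem not_exists_entire_extension {φ : Fin 2 → ℂ → ℂ}
    (hφ : ∀ b, DifferentiableOn ℂ (φ b) (ball 0 1)) {S : Set (Fin n → ℂ)}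
    (hS : ∀ F : (Fin n → ℂ) → (Fin n → ℂ), Differentiable ℂ F → (∀ x, F x ∉ S) →
      ∀ x, (fderiv ℂ F x).det = 0)
    {h : (Fin (3 * n) → ℂ) → (Fin n → ℂ)} (hh : Differentiable ℂ h) (hhS : ∀ x, h x ∉ S)
    (hhX : ∀ x ∈ polydiscGraph n φ, ∀ i, h x i = x (finProdFinEquiv (0, i))) : False := by
  let γ : (Fin n → ℂ) → Fin (3 * n) → ℂ := tripleMap (Fin.cons id φ)
  have hγ : DifferentiableAt ℂ γ 0 := differentiableAt_tripleMap fun k i => by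
    refine Fin.cases ?_ (fun b => ?_) k
    · exact differentiableAt_id
    · simpa using (hφ b).differentiableAt (isOpen_ball.mem_nhds (mem_ball_self one_pos))
  have hid : (fun z => h (γ z)) =ᶠ[𝓝 0] id := by
    filter_upwards [ball_mem_nhds (0 : Fin n → ℂ) one_pos] with z hz
    have hz' : ∀ i, ‖z i‖ < 1 := fun i => (norm_le_pi_norm z i).trans_lt (by simpa using hz)
    ext i
    rw [hhX _ (tripleMap_mem_polydiscGraph hz')]
    simp [tripleMap]
  have hcomp : (fderiv ℂ h (γ 0)).comp (fderiv ℂ γ 0) = ContinuousLinearMap.id ℂ _ := by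
    have h1 : HasFDerivAt (fun z => h (γ z)) _ 0 := (hh (γ 0)).hasFDerivAt.comp 0 hγ.hasFDerivAt
    exact h1.unique ((hasFDerivAt_id 0).congr_of_eventuallyEq hid)
  let L := fderiv ℂ γ 0
  have hH : fderiv ℂ (fun z => h (γ 0 + L z)) 0 = ContinuousLinearMap.id ℂ _ := by
    have h1 : HasFDerivAt h (fderiv ℂ h (γ 0)) (γ 0 + L 0) := by
      simpa using (hh (γ 0)).hasFDerivAt
    have h2 : HasFDerivAt (fun z => h (γ 0 + L z)) _ 0 :=
      h1.comp 0 (L.hasFDerivAt.const_add (γ 0))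
    rw [h2.fderiv, hcomp]
  have := hS (fun z => h (γ 0 + L z)) (by fun_prop) (fun x => hhS _) 0
  rw [hH] at this
  simp [ContinuousLinearMap.det] at this

theorem exists_counterexample_in_dimension (n : ℕ) (hn : 1 ≤ n) :
    ∃ S : Set (Fin n → ℂ), IsClosedDiscrete S ∧
      ∃ (N : ℕ) (Xo : TopologicalSpace.Opens (Fin N → ℂ)),
        IsSteinManifold (Fin N → ℂ) Xo ∧
        ∃ X₀ : Set Xo, IsClosedComplexSubmanifold (Fin N → ℂ) X₀ ∧
        ∃ f₀ : Xo → (Fin n → ℂ), Continuous f₀ ∧ (∀ x, f₀ x ∉ S) ∧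
          HolomorphicOnSubvariety (Fin N → ℂ) (Fin n → ℂ) f₀ X₀ ∧
          ¬ ∃ F : unitInterval × Xo → (Fin n → ℂ),
            Continuous F ∧ (∀ z, F z ∉ S) ∧ (∀ x, F (0, x) = f₀ x) ∧
            Holomorphic (Fin N → ℂ) (Fin n → ℂ) (fun x => F (1, x)) ∧
            (∀ t, ∀ x ∈ X₀, F (t, x) = f₀ x) := by
  have : NeZero n := ⟨by omega⟩
  obtain ⟨φ, hφ, hφM⟩ := exists_proper_pair_on_disc
  obtain ⟨S, hSfin, -, hSR, hS⟩ := exists_unavoidable_set (V := Fin n → ℂ) (Z := ∅)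
    (by simp) zero_le_one
  let X₀ : Set (⊤ : Opens (Fin (3 * n) → ℂ)) :=
    {x | (x : Fin (3 * n) → ℂ) ∈ polydiscGraph n φ}
  let f₀ : (⊤ : Opens (Fin (3 * n) → ℂ)) → (Fin n → ℂ) := fun x i =>
    ((max 1 ‖x.1 (finProdFinEquiv (0, i))‖)⁻¹ : ℝ) • x.1 (finProdFinEquiv (0, i))
  have hf₀X : ∀ x ∈ X₀, ∀ i, f₀ x i = x.1 (finProdFinEquiv (0, i)) := fun x hx i => by
    simp [f₀, max_eq_left (hx i).1.le]
  refine ⟨S, isClosedDiscrete_of_finite_inter_closedBall hSfin, 3 * n, ⊤, isSteinManifold_top _,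
    X₀, isClosedComplexSubmanifold_polydiscGraph hφ hφM, f₀, ?_, fun x hx => ?_, fun x _ => ?_, ?_⟩
  · refine continuous_pi fun i => ?_
    have hc : Continuous fun x : (⊤ : Opens (Fin (3 * n) → ℂ)) =>
        x.1 (finProdFinEquiv (0, i)) := (continuous_apply _).comp continuous_subtype_val
    exact ((continuous_const.max hc.norm).inv₀ fun x => by positivity).smul hc
  · refine absurd (hSR _ hx) (not_lt.mpr ((pi_norm_le_iff_of_nonneg zero_le_one).mpr fun i => ?_))
    have : (0 : ℝ) < max 1 ‖x.1 (finProdFinEquiv (0, i))‖ := by positivity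
    simp only [f₀]
    rw [norm_smul, norm_inv, Real.norm_of_nonneg this.le, inv_mul_le_iff₀ this, mul_one]
    exact le_max_right _ _
  · refine ⟨univ, isOpen_univ, mem_univ _, fun x i => x.1 (finProdFinEquiv (0, i)),
      fun y _ => MDifferentiableAt.mdifferentiableWithinAt ?_,
      fun y hy => funext fun i => hf₀X y hy.1 i⟩
    exact mdifferentiableAt_comp_val_iff
      (g := fun x : Fin (3 * n) → ℂ => fun i : Fin n => x (finProdFinEquiv (0, i))).mpr
      (by fun_prop)
  · rintro ⟨F, -, hFS, -, hF1, hFX⟩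
    obtain ⟨h, hhF, hh⟩ := exists_extension_of_holomorphic hF1
    refine not_exists_entire_extension hφ hS (h := h) (fun x => hh x trivial)
      (fun x => ?_) (fun x hx i => ?_)
    · rw [hhF ⟨x, trivial⟩]; exact hFS _
    · rw [hhF ⟨x, trivial⟩, hFX 1 ⟨x, trivial⟩ hx]
      exact hf₀X ⟨x, trivial⟩ hx i

end HigherDimension


/-! ### Entire maps of the plane restricted to a curve -/

section Curve

open Metric Filter

theorem eventually_eq_zero_of_fderiv_dependent {φ s u : ℂ × ℂ → ℂ} (hφ : Differentiable ℂ φ)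
    (hs : Differentiable ℂ s) (hu : Differentiable ℂ u)
    (hdep : ∀ x v w, fderiv ℂ φ x v = 1 → fderiv ℂ φ x w = 0 → fderiv ℂ u x w = 0)
    {x₀ : ℂ × ℂ} (hx₀ : s x₀ = 0) (hsu : ∀ x, s x = 0 → u x = 0)
    (hinj : ∀ v, fderiv ℂ φ x₀ v = 0 → fderiv ℂ s x₀ v = 0 → v = 0) :
    ∀ᶠ x in 𝓝 x₀, u x = 0 := by
  set Φ : ℂ × ℂ → ℂ × ℂ := fun x => (φ x, s x) with hΦ
  have hΦd : Differentiable ℂ Φ := hφ.prodMk hs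
  have hΦ' : ∀ x v, fderiv ℂ Φ x v = (fderiv ℂ φ x v, fderiv ℂ s x v) := fun x v => by
    rw [((hφ x).hasFDerivAt.prodMk (hs x).hasFDerivAt).fderiv]; rfl
  have hcd : ContDiffAt ℂ 1 Φ x₀ := (contDiff_of_differentiable 1 hΦd).contDiffAt
  have hker : LinearMap.ker (fderiv ℂ Φ x₀ : ℂ × ℂ →ₗ[ℂ] ℂ × ℂ) = ⊥ := by
    refine LinearMap.ker_eq_bot'.mpr fun v hv => ?_
    have h1 : fderiv ℂ Φ x₀ v = 0 := hv
    rw [hΦ', Prod.mk_eq_zero] at h1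
    exact hinj v h1.1 h1.2
  have hdet : (fderiv ℂ Φ x₀).det ≠ 0 := fun h0 =>
    (LinearMap.bot_lt_ker_of_det_eq_zero h0).ne' hker
  set e := (fderiv ℂ Φ x₀).toContinuousLinearEquivOfDetNeZero hdet with he
  have hfe : HasFDerivAt Φ (e : ℂ × ℂ →L[ℂ] ℂ × ℂ) x₀ := by
    rw [he, ContinuousLinearMap.coe_toContinuousLinearEquivOfDetNeZero]
    exact (hΦd x₀).hasFDerivAt
  have hst : HasStrictFDerivAt Φ (e : ℂ × ℂ →L[ℂ] ℂ × ℂ) x₀ :=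
    hcd.hasStrictFDerivAt' hfe (by simp)
  set G := hst.localInverse Φ e x₀ with hG
  have hy₀ : Φ x₀ = (φ x₀, 0) := by rw [hΦ]; simp [hx₀]
  have hGcd : ContDiffAt ℂ 1 G (Φ x₀) := hcd.to_localInverse hfe one_ne_zero
  have hev : ∀ᶠ y in 𝓝 (Φ x₀), DifferentiableAt ℂ G y ∧ Φ (G y) = y :=
    ((hGcd.eventually (by simp)).mono fun y hy => hy.differentiableAt (by simp)).and
      hst.eventually_right_inverse
  rw [hy₀] at hev
  obtain ⟨r, hr, hball⟩ := Metric.eventually_nhds_iff_ball.mp hev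
  have hd : ∀ y ∈ ball (φ x₀, (0 : ℂ)) r, fderiv ℂ (fun y => u (G y)) y (0, 1) = 0 := by
    intro y hy
    obtain ⟨hGy, -⟩ := hball y hy
    have hid : (fderiv ℂ Φ (G y)).comp (fderiv ℂ G y) = ContinuousLinearMap.id ℂ _ := by
      have h1 : HasFDerivAt (fun z => Φ (G z)) ((fderiv ℂ Φ (G y)).comp (fderiv ℂ G y)) y :=
        (hΦd (G y)).hasFDerivAt.comp y hGy.hasFDerivAt
      refine h1.unique ((hasFDerivAt_id y).congr_of_eventuallyEq ?_)
      filter_upwards [isOpen_ball.mem_nhds hy] with z hz using (hball z hz).2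
    have hpt : ∀ v, fderiv ℂ Φ (G y) (fderiv ℂ G y v) = v := fun v => by
      rw [← ContinuousLinearMap.comp_apply, hid]; rfl
    have h1 := hpt (1, 0)
    have h2 := hpt (0, 1)
    rw [hΦ', Prod.mk.injEq] at h1 h2
    have h3 : HasFDerivAt (fun z => u (G z)) ((fderiv ℂ u (G y)).comp (fderiv ℂ G y)) y :=
      (hu (G y)).hasFDerivAt.comp y hGy.hasFDerivAt
    rw [h3.fderiv]
    exact hdep _ _ _ h1.1 h2.1
  have hzero : ∀ y ∈ ball (φ x₀, (0 : ℂ)) r, u (G y) = 0 := by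
    rintro ⟨a, b⟩ hy
    have hmem : ∀ t ∈ ball (0 : ℂ) r, (a, t) ∈ ball (φ x₀, (0 : ℂ)) r := fun t ht => by
      rw [← ball_prod_same] at hy ⊢
      exact ⟨hy.1, ht⟩
    have hb : b ∈ ball (0 : ℂ) r := by
      rw [← ball_prod_same] at hy
      exact hy.2
    have hder : ∀ t ∈ ball (0 : ℂ) r, HasDerivAt (fun t => u (G (a, t))) 0 t := fun t ht => by
      have h1 : DifferentiableAt ℂ (fun y => u (G y)) (a, t) :=
        (hu _).comp _ (hball _ (hmem t ht)).1
      have h2 : HasDerivAt (fun t : ℂ => (a, t)) ((0 : ℂ), (1 : ℂ)) t :=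
        (hasDerivAt_const t a).prodMk (hasDerivAt_id t)
      have h3 := h1.hasFDerivAt.comp_hasDerivAt t h2
      rwa [hd _ (hmem t ht)] at h3
    have hconst := isOpen_ball.is_const_of_deriv_eq_zero (convex_ball (0 : ℂ) r).isPreconnected
      (fun t ht => (hder t ht).differentiableAt.differentiableWithinAt)
      (fun t ht => (hder t ht).deriv) hb (mem_ball_self hr)
    refine hconst.trans (hsu _ ?_)
    exact congrArg Prod.snd (hball _ (hmem 0 (mem_ball_self hr))).2
  have hcont : Tendsto Φ (𝓝 x₀) (𝓝 (φ x₀, 0)) := hy₀ ▸ hΦd.continuous.continuousAt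
  filter_upwards [hst.eventually_left_inverse, hcont (ball_mem_nhds _ hr)] with x hx hx'
  rw [← hx]
  exact hzero _ hx'

theorem eq_zero_of_eventually_eq_zero {V : Type*} [NormedAddCommGroup V] [NormedSpace ℂ V]
    {u : V → ℂ} (hu : Differentiable ℂ u) {x₀ : V} (h : ∀ᶠ x in 𝓝 x₀, u x = 0) (x : V) :
    u x = 0 := by
  have hl : Differentiable ℂ fun t : ℂ => u (x₀ + t • (x - x₀)) := by fun_prop
  have hc : Tendsto (fun t : ℂ => x₀ + t • (x - x₀)) (𝓝 0) (𝓝 x₀) := by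
    have : Continuous fun t : ℂ => x₀ + t • (x - x₀) := by fun_prop
    simpa using this.tendsto 0
  have ha := Complex.analyticOnNhd_univ_iff_differentiable.mpr hl
  have h0 := ha.eqOn_zero_of_preconnected_of_eventuallyEq_zero isPreconnected_univ (mem_univ 0)
    (hc.eventually h)
  simpa using h0 (mem_univ 1)

theorem add_eq_one_of_eq_exp_on_curve {φ ψ : ℂ × ℂ → ℂ} (hφ : Differentiable ℂ φ)
    (hψ : Differentiable ℂ ψ) (hdet : ∀ x, (fderiv ℂ (fun y => (φ y, ψ y)) x).det = 0)
    (hφC : ∀ x : ℂ × ℂ, Complex.exp x.1 + Complex.exp x.2 = 1 → φ x = Complex.exp x.1)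
    (hψC : ∀ x : ℂ × ℂ, Complex.exp x.1 + Complex.exp x.2 = 1 → ψ x = Complex.exp x.2)
    (x : ℂ × ℂ) : φ x + ψ x = 1 := by
  set s : ℂ × ℂ → ℂ := fun y => Complex.exp y.1 + Complex.exp y.2 - 1 with hs
  set u : ℂ × ℂ → ℂ := fun y => φ y + ψ y - 1 with hu
  have hsd : Differentiable ℂ s := by fun_prop
  have hud : Differentiable ℂ u := by fun_prop
  set l : ℂ := Complex.log (1 / 2) with hl
  have hel : Complex.exp l = 1 / 2 := Complex.exp_log (by norm_num)
  have hs0 : s (l, l) = 0 := by simp only [hs, hel]; norm_num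
  have hs' : ∀ v, fderiv ℂ s (l, l) v = 1 / 2 * (v.1 + v.2) := fun v => by
    have h1 : HasFDerivAt s (Complex.exp l • ContinuousLinearMap.fst ℂ ℂ ℂ +
        Complex.exp l • ContinuousLinearMap.snd ℂ ℂ ℂ) (l, l) := by
      have h2 : HasFDerivAt (fun y : ℂ × ℂ => Complex.exp y.1) _ (l, l) :=
        (hasFDerivAt_fst (𝕜 := ℂ)).cexp
      have h3 : HasFDerivAt (fun y : ℂ × ℂ => Complex.exp y.2) _ (l, l) :=
        (hasFDerivAt_snd (𝕜 := ℂ)).cexp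
      exact (h2.add h3).sub_const 1
    rw [h1.fderiv]
    simp [hel]; ring
  have hφ' : fderiv ℂ φ (l, l) (1, -1) = 1 / 2 := by
    have he : HasDerivAt (fun t : ℂ => Complex.exp (l + t)) (1 / 2) 0 := by
      simpa [hel] using ((hasDerivAt_id (0 : ℂ)).const_add l).cexp
    have hlog : HasDerivAt (fun t : ℂ => Complex.log (1 - Complex.exp (l + t))) (-1) 0 := by
      have h1 := (he.const_sub 1).clog (by simp [hel]; norm_num [Complex.slitPlane])
      refine h1.congr_deriv ?_
      simp [hel]; norm_num
    have hγ : HasDerivAt (fun t : ℂ => (l + t, Complex.log (1 - Complex.exp (l + t))))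
        ((1 : ℂ), (-1 : ℂ)) 0 :=
      ((hasDerivAt_id (0 : ℂ)).const_add l).prodMk hlog
    have hγ0 : (l + 0, Complex.log (1 - Complex.exp (l + 0))) = (l, l) := by
      rw [add_zero, hel, hl]; norm_num
    have h1 : HasFDerivAt φ (fderiv ℂ φ (l, l))
        (l + 0, Complex.log (1 - Complex.exp (l + 0))) := by
      rw [hγ0]; exact (hφ _).hasFDerivAt
    refine (h1.comp_hasDerivAt (0 : ℂ) hγ).unique (he.congr_of_eventuallyEq ?_)
    have hne : ∀ᶠ t : ℂ in 𝓝 0, 1 - Complex.exp (l + t) ≠ 0 :=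
      (by fun_prop : Continuous fun t : ℂ => 1 - Complex.exp (l + t)).continuousAt.eventually_ne
        (by rw [add_zero, hel]; norm_num)
    filter_upwards [hne] with t ht
    exact hφC _ (by simp [Complex.exp_log ht])
  have hev : ∀ᶠ y in 𝓝 ((l, l) : ℂ × ℂ), u y = 0 := by
    refine eventually_eq_zero_of_fderiv_dependent hφ hsd hud ?_ hs0 ?_ ?_
    · intro y v w hv hw
      have hF : ∀ z, fderiv ℂ (fun y => (φ y, ψ y)) y z = (fderiv ℂ φ y z, fderiv ℂ ψ y z) :=
        fun z => by rw [((hφ y).hasFDerivAt.prodMk (hψ y).hasFDerivAt).fderiv]; rfl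
      have huw : fderiv ℂ u y w = fderiv ℂ φ y w + fderiv ℂ ψ y w := by
        have h1 : HasFDerivAt u (fderiv ℂ φ y + fderiv ℂ ψ y) y :=
          ((hφ y).hasFDerivAt.add (hψ y).hasFDerivAt).sub_const 1
        rw [h1.fderiv]; rfl
      rw [huw, hw, zero_add]
      by_contra hne
      refine (LinearMap.range_lt_top_of_det_eq_zero (hdet y)).ne
        (LinearMap.range_eq_top.mpr fun p => ?_)
      refine ⟨p.1 • v + ((p.2 - p.1 * fderiv ℂ ψ y v) / fderiv ℂ ψ y w) • w, ?_⟩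
      rw [ContinuousLinearMap.coe_coe, hF]
      simp only [map_add, map_smul, hv, hw, smul_eq_mul]
      ext <;> simp
      field_simp
      ring
    · intro y hy
      have h1 : Complex.exp y.1 + Complex.exp y.2 = 1 := sub_eq_zero.mp hy
      simp only [hu, hφC y h1, hψC y h1, h1, sub_self]
    · intro v hv hsv
      rw [hs'] at hsv
      have h2 : v = v.1 • ((1 : ℂ), (-1 : ℂ)) := by
        ext
        · simp
        · simp; linear_combination 2 * hsv
      rw [h2, map_smul, hφ', smul_eq_mul] at hv
      have h3 : v.1 = 0 := by linear_combination 2 * hv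
      rw [h2, h3, zero_smul]
  exact sub_eq_zero.mp (eq_zero_of_eventually_eq_zero hud hev x)

end Curve

/-! ### Logarithms of entire functions omitting two values -/

section Logarithms

open Filter

theorem exists_differentiable_exp_eq {V : Type*} [NormedAddCommGroup V] [NormedSpace ℂ V]
    {φ : V → ℂ} (hφ : Differentiable ℂ φ) (h0 : ∀ x, φ x ≠ 0) :
    ∃ A : V → ℂ, Differentiable ℂ A ∧ ∀ x, Complex.exp (A x) = φ x := by
  let _ : NormedSpace ℝ V := NormedSpace.restrictScalars ℝ ℂ V
  have hsc : IsSimplyConnected (univ : Set V) := by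
    have : ContractibleSpace (univ : Set V) := convex_univ.contractibleSpace univ_nonempty
    exact inferInstanceAs (SimplyConnectedSpace (univ : Set V))
  obtain ⟨A, hAc, hA⟩ := Complex.exists_continuousOn_eqOn_exp_comp hsc isOpen_univ
    (g := φ) hφ.continuous.continuousOn (by rintro ⟨x, -, hx⟩; exact h0 x hx)
  have hA' : ∀ x, Complex.exp (A x) = φ x := fun x => hA (mem_univ x)
  rw [continuousOn_univ] at hAc
  refine ⟨A, fun x₀ => ?_, hA'⟩
  have hd : DifferentiableAt ℂ (fun x => A x₀ + Complex.log (φ x * (φ x₀)⁻¹)) x₀ := by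
    refine ((hφ x₀).mul_const (φ x₀)⁻¹).clog ?_ |>.const_add _
    rw [mul_inv_cancel₀ (h0 x₀)]
    exact Complex.one_mem_slitPlane
  refine hd.congr_of_eventuallyEq ?_
  have hsmall : ∀ᶠ x in 𝓝 x₀, (A x - A x₀).im ∈ Ioo (-Real.pi) Real.pi := by
    have hc : Continuous fun x => (A x - A x₀).im := by fun_prop
    exact hc.continuousAt (isOpen_Ioo.mem_nhds (by simp [Real.pi_pos]))
  filter_upwards [hsmall] with x hx
  rw [← hA', ← hA', ← div_eq_mul_inv, ← Complex.exp_sub, Complex.log_exp hx.1 hx.2.le]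
  ring

theorem eq_of_exp_eq_one {T : Type*} [TopologicalSpace T] [PreconnectedSpace T] {g : T → ℂ}
    (hg : Continuous g) (h : ∀ x, Complex.exp (g x) = 1) (x y : T) : g x = g y := by
  refine IsLocallyConstant.apply_eq_of_preconnectedSpace
    ((IsLocallyConstant.iff_eventually_eq g).mpr fun x₀ => ?_) x y
  have hsmall : ∀ᶠ x in 𝓝 x₀, (g x - g x₀).im ∈ Ioo (-Real.pi) Real.pi := by
    have hc : Continuous fun x => (g x - g x₀).im := by fun_prop
    exact hc.continuousAt (isOpen_Ioo.mem_nhds (by simp [Real.pi_pos]))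
  filter_upwards [hsmall] with x hx
  have h1 := Complex.log_exp hx.1 hx.2.le
  rw [Complex.exp_sub, h, h, div_one, Complex.log_one] at h1
  exact (sub_eq_zero.mp h1.symm)

theorem period_of_eq_exp_on_curve {A B : ℂ × ℂ → ℂ} (hA : Continuous A) (hB : Continuous B)
    (hAC : ∀ x : ℂ × ℂ, Complex.exp x.1 + Complex.exp x.2 = 1 →
      Complex.exp (A x) = Complex.exp x.1)
    (hBC : ∀ x : ℂ × ℂ, Complex.exp x.1 + Complex.exp x.2 = 1 →
      Complex.exp (B x) = Complex.exp x.2)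
    (hAp : ∀ x, Complex.exp (A (x + (2 * Real.pi * Complex.I, 0))) = Complex.exp (A x))
    (hBp : ∀ x, Complex.exp (B (x + (2 * Real.pi * Complex.I, 0))) = Complex.exp (B x))
    (x : ℂ × ℂ) : A (x + (2 * Real.pi * Complex.I, 0)) = A x + 2 * Real.pi * Complex.I ∧
      B (x + (2 * Real.pi * Complex.I, 0)) = B x := by
  set τ : ℂ := 2 * Real.pi * Complex.I with hτ
  set a : ℝ → ℂ := fun θ => -1 + θ * Complex.I with ha
  set b : ℝ → ℂ := fun θ => Complex.log (1 - Complex.exp (a θ)) with hb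
  have hac : Continuous a := by fun_prop
  have hlt : ∀ θ, ‖Complex.exp (a θ)‖ < 1 := fun θ => by
    rw [Complex.norm_exp]; simp [ha]
  have hslit : ∀ θ, 1 - Complex.exp (a θ) ∈ Complex.slitPlane := fun θ => by
    refine Or.inl ?_
    have := (Complex.re_le_norm (Complex.exp (a θ))).trans_lt (hlt θ)
    simpa using this
  have hbc : Continuous b :=
    Continuous.clog (continuous_const.sub (Complex.continuous_exp.comp hac)) hslit
  have hexpb : ∀ θ, Complex.exp (b θ) = 1 - Complex.exp (a θ) := fun θ =>
    Complex.exp_log (Complex.slitPlane_ne_zero (hslit θ))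
  have hC : ∀ θ, Complex.exp (a θ) + Complex.exp (b θ) = 1 := fun θ => by rw [hexpb]; ring
  have ha2 : a (2 * Real.pi) = a 0 + τ := by simp [ha, hτ]
  have hb2 : b (2 * Real.pi) = b 0 := by
    simp only [hb, ha2, hτ, Complex.exp_add, Complex.exp_two_pi_mul_I, mul_one]
  have hp : ((a (2 * Real.pi), b (2 * Real.pi)) : ℂ × ℂ) = (a 0, b 0) + (τ, 0) := by
    rw [ha2, hb2]; simp
  constructor
  · have h1 := eq_of_exp_eq_one (g := fun x => A (x + (τ, 0)) - A x) (by fun_prop)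
      (fun x => by rw [Complex.exp_sub, hAp, div_self (Complex.exp_ne_zero _)]) x (a 0, b 0)
    have h2 := eq_of_exp_eq_one (g := fun θ => A (a θ, b θ) - a θ) (by fun_prop)
      (fun θ => by rw [Complex.exp_sub, hAC _ (hC θ), div_self (Complex.exp_ne_zero _)])
      (2 * Real.pi) 0
    rw [hp, ha2] at h2
    linear_combination h1 + h2
  · have h1 := eq_of_exp_eq_one (g := fun x => B (x + (τ, 0)) - B x) (by fun_prop)
      (fun x => by rw [Complex.exp_sub, hBp, div_self (Complex.exp_ne_zero _)]) x (a 0, b 0)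
    have h2 := eq_of_exp_eq_one (g := fun θ => B (a θ, b θ) - b θ) (by fun_prop)
      (fun θ => by rw [Complex.exp_sub, hBC _ (hC θ), div_self (Complex.exp_ne_zero _)])
      (2 * Real.pi) 0
    rw [hp, hb2] at h2
    linear_combination h1 + h2

theorem not_periods_of_exp_add_exp_eq_one {A B : ℂ × ℂ → ℂ} (hA : Differentiable ℂ A)
    (hB : Differentiable ℂ B) (hAB : ∀ x, Complex.exp (A x) + Complex.exp (B x) = 1)
    {τ : ℂ} (hτ : τ = 2 * Real.pi * Complex.I)
    (hA1 : ∀ x, A (x + (τ, 0)) = A x + τ) (hA2 : ∀ x, A (x + (0, τ)) = A x)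
    (hB1 : ∀ x, B (x + (τ, 0)) = B x) (hB2 : ∀ x, B (x + (0, τ)) = B x + τ) : False := by
  have hτ0 : τ ≠ 0 := by rw [hτ]; exact Complex.two_pi_I_ne_zero
  set v₁ : ℂ × ℂ := (Complex.I, 0) with hv₁
  set v₂ : ℂ × ℂ := (0, Complex.I) with hv₂
  set ι : ℝ × ℝ →L[ℝ] ℂ × ℂ :=
    (ContinuousLinearMap.fst ℝ ℝ ℝ).smulRight v₁ + (ContinuousLinearMap.snd ℝ ℝ ℝ).smulRight v₂
    with hι
  have hιv : ∀ s t, ι (s, t) = s • v₁ + t • v₂ := fun s t => rfl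
  have hι1 : ι (1, 0) = v₁ := by rw [hιv]; simp
  have hι2 : ι (0, 1) = v₂ := by rw [hιv]; simp
  have hshift1 : ∀ s t, ι (s + 2 * Real.pi, t) = ι (s, t) + (τ, 0) := fun s t => by
    rw [hιv, hιv, hτ, hv₁, hv₂]; ext <;> simp; ring
  have hshift2 : ∀ s t, ι (s, t + 2 * Real.pi) = ι (s, t) + (0, τ) := fun s t => by
    rw [hιv, hιv, hτ, hv₁, hv₂]; ext <;> simp; ring
  have hA' := differentiable_fderiv hA
  have hAD : ∀ x, HasFDerivAt A (fderiv ℂ A x) x := fun x => (hA x).hasFDerivAt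
  set D : ℂ × ℂ → (ℂ × ℂ →L[ℂ] ℂ) := fderiv ℂ A with hD
  have hD1 : ∀ x, D (x + (τ, 0)) = D x := fun x => by
    rw [hD, ← fderiv_comp_add_right, funext hA1, fderiv_add_const]
  have hD2 : ∀ x, D (x + (0, τ)) = D x := fun x => by
    rw [hD, ← fderiv_comp_add_right, funext hA2]
  clear_value D
  have hwedge : ∀ x, D x v₂ * fderiv ℂ B x v₁ - D x v₁ * fderiv ℂ B x v₂ = 0 := fun x => by
    have h1 : HasFDerivAt (fun x => Complex.exp (A x) + Complex.exp (B x))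
        (Complex.exp (A x) • D x + Complex.exp (B x) • fderiv ℂ B x) x :=
      (hAD x).cexp.add (hB x).hasFDerivAt.cexp
    rw [funext hAB] at h1
    have h2 := h1.unique (hasFDerivAt_const (1 : ℂ) x)
    have h3 := DFunLike.congr_fun h2 v₁
    have h4 := DFunLike.congr_fun h2 v₂
    simp only [add_apply, smul_apply, smul_eq_mul,
      zero_apply] at h3 h4
    refine (mul_eq_zero.mp (?_ : Complex.exp (B x) * _ = 0)).resolve_left (Complex.exp_ne_zero _)
    linear_combination D x v₂ * h3 - D x v₁ * h4
  have hprod : ∀ v x, HasFDerivAt (fun x => B x * D x v)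
      (B x • (fderiv ℂ D x).flip v + D x v • fderiv ℂ B x) x := fun v x =>
    (hB x).hasFDerivAt.mul (((hA' x).hasFDerivAt.clm_apply (hasFDerivAt_const v x)).congr_fderiv
      (by simp))
  have hpull : ∀ v p, HasFDerivAt (fun p => B (ι p) * D (ι p) v)
      (((B (ι p) • (fderiv ℂ D (ι p)).flip v + D (ι p) v • fderiv ℂ B (ι p)).restrictScalars
        ℝ).comp ι) p := fun v p => ((hprod v (ι p)).restrictScalars ℝ).comp p ι.hasFDerivAt
  have h_integrand : ∀ p, ((((B (ι p) • (fderiv ℂ D (ι p)).flip v₂ +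
      D (ι p) v₂ • fderiv ℂ B (ι p)).restrictScalars ℝ).comp ι) (1, 0)) +
      ((-(((B (ι p) • (fderiv ℂ D (ι p)).flip v₁ +
      D (ι p) v₁ • fderiv ℂ B (ι p)).restrictScalars ℝ).comp ι)) (0, 1)) = 0 := fun p => by
    have hsymm := second_derivative_symmetric hAD
      (hA' (ι p)).hasFDerivAt v₁ v₂
    simp only [neg_apply, ContinuousLinearMap.comp_apply, hι1, hι2,
      ContinuousLinearMap.coe_restrictScalars', add_apply,
      smul_apply, ContinuousLinearMap.flip_apply, smul_eq_mul]
    linear_combination hwedge (ι p) + B (ι p) * hsymm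
  have hdiv := MeasureTheory.integral2_divergence_prod_of_hasFDerivAt
    (fun p => B (ι p) * D (ι p) v₂) (fun p => -(B (ι p) * D (ι p) v₁)) _ _
    0 0 (2 * Real.pi) (2 * Real.pi)
    (fun p _ => (hpull v₂ p).continuousAt.continuousWithinAt)
    (fun p _ => (hpull v₁ p).neg.continuousAt.continuousWithinAt)
    (fun p _ => hpull v₂ p) (fun p _ => (hpull v₁ p).neg)
    (by simp only [h_integrand]; exact MeasureTheory.integrableOn_zero)
  simp only [h_integrand, intervalIntegral.integral_zero] at hdiv
  have hbdry : ∀ t, B (ι (2 * Real.pi, t)) * D (ι (2 * Real.pi, t)) v₂ =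
      B (ι (0, t)) * D (ι (0, t)) v₂ := fun t => by
    have h1 := hshift1 0 t
    rw [zero_add] at h1
    rw [h1, hB1, hD1]
  have hbdry' : ∀ s, -(B (ι (s, 2 * Real.pi)) * D (ι (s, 2 * Real.pi)) v₁) =
      -(B (ι (s, 0)) * D (ι (s, 0)) v₁) - τ * D (ι (s, 0)) v₁ := fun s => by
    have h1 := hshift2 s 0
    rw [zero_add] at h1
    rw [h1, hB2, hD2]; ring
  have hcont : ∀ v, Continuous fun s : ℝ => D (ι (s, 0)) v := fun v => by
    have h1 : Continuous D := hA'.continuous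
    fun_prop
  have hBcont : Continuous B := hB.continuous
  have hcB : Continuous fun s : ℝ => -(B (ι (s, 0)) * D (ι (s, 0)) v₁) :=
    ((hBcont.comp (ι.continuous.comp (by fun_prop))).mul (hcont v₁)).neg
  have hftc : ∫ s in (0 : ℝ)..2 * Real.pi, D (ι (s, 0)) v₁ = τ := by
    have hder : ∀ s : ℝ, HasDerivAt (fun s : ℝ => A (ι (s, 0))) (D (ι (s, 0)) v₁) s := fun s => by
      have h1 : HasDerivAt (fun s : ℝ => ι (s, 0)) v₁ s := by
        have := ι.hasFDerivAt.comp_hasDerivAt s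
          ((hasDerivAt_id s).prodMk (hasDerivAt_const s (0 : ℝ)))
        rwa [hι1] at this
      exact ((hAD (ι (s, 0))).restrictScalars ℝ).comp_hasDerivAt s h1
    rw [intervalIntegral.integral_eq_sub_of_hasDerivAt (fun s _ => hder s)
      ((hcont v₁).intervalIntegrable _ _)]
    have h1 := hshift1 0 0
    rw [zero_add] at h1
    rw [h1, hA1]; ring
  simp only [hbdry, hbdry'] at hdiv
  rw [intervalIntegral.integral_sub (hcB.intervalIntegrable _ _)
    (((hcont v₁).const_mul τ).intervalIntegrable _ _), intervalIntegral.integral_const_mul,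
    hftc] at hdiv
  exact mul_ne_zero hτ0 hτ0 (by linear_combination hdiv)

theorem not_eq_exp_on_curve_of_periodic {F : ℂ × ℂ → ℂ × ℂ} (hF : Differentiable ℂ F)
    (hdet : ∀ x, (fderiv ℂ F x).det = 0) (hp : ∀ x, F x ≠ (1, 0)) (hq : ∀ x, F x ≠ (0, 1))
    (hFC : ∀ x : ℂ × ℂ, Complex.exp x.1 + Complex.exp x.2 = 1 →
      F x = (Complex.exp x.1, Complex.exp x.2))
    (hF1 : ∀ x, F (x + (2 * Real.pi * Complex.I, 0)) = F x)
    (hF2 : ∀ x, F (x + (0, 2 * Real.pi * Complex.I)) = F x) : False := by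
  have hsum := add_eq_one_of_eq_exp_on_curve hF.fst hF.snd hdet
    (fun x hx => by rw [hFC x hx]) (fun x hx => by rw [hFC x hx])
  obtain ⟨A, hA, hAF⟩ := exists_differentiable_exp_eq hF.fst fun x h0 =>
    hq x (Prod.ext h0 (by have := hsum x; rwa [h0, zero_add] at this))
  obtain ⟨B, hB, hBF⟩ := exists_differentiable_exp_eq hF.snd fun x h0 =>
    hp x (Prod.ext (by have := hsum x; rwa [h0, add_zero] at this) h0)
  have hAC : ∀ x : ℂ × ℂ, Complex.exp x.1 + Complex.exp x.2 = 1 →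
      Complex.exp (A x) = Complex.exp x.1 := fun x hx => by rw [hAF, hFC x hx]
  have hBC : ∀ x : ℂ × ℂ, Complex.exp x.1 + Complex.exp x.2 = 1 →
      Complex.exp (B x) = Complex.exp x.2 := fun x hx => by rw [hBF, hFC x hx]
  have h1 := period_of_eq_exp_on_curve hA.continuous hB.continuous hAC hBC
    (fun x => by rw [hAF, hAF, hF1]) (fun x => by rw [hBF, hBF, hF1])
  have hswap : ∀ x : ℂ × ℂ, (x + (2 * Real.pi * Complex.I, 0)).swap =
      x.swap + (0, 2 * Real.pi * Complex.I) := fun x => rfl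
  have h2 := period_of_eq_exp_on_curve (A := fun x => B x.swap) (B := fun x => A x.swap)
    (hB.continuous.comp continuous_swap) (hA.continuous.comp continuous_swap)
    (fun x hx => hBC x.swap (by rwa [add_comm] at hx))
    (fun x hx => hAC x.swap (by rwa [add_comm] at hx))
    (fun x => by rw [hBF, hBF, hswap, hF2]) (fun x => by rw [hAF, hAF, hswap, hF2])
  exact not_periods_of_exp_add_exp_eq_one hA hB (fun x => by rw [hAF, hBF, hsum]) rfl
    (fun x => (h1 x).1) (fun x => (h2 x.swap).2) (fun x => (h1 x).2) (fun x => (h2 x.swap).1)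

end Logarithms

/-! ### The complement of the coordinate axes -/

section Axes

open Metric Filter

theorem isSteinManifold_cStarSq : IsSteinManifold (ℂ × ℂ) CStarSq := by
  set g : ℂ × ℂ → Fin 3 → ℂ := fun z => ![z.1, z.2, (z.1 * z.2)⁻¹] with hg
  have hd : ∀ x ∈ CStarSq, DifferentiableAt ℂ g x := fun x hx => by
    refine differentiableAt_pi.mpr fun i => ?_
    fin_cases i
    · exact differentiableAt_fst
    · exact differentiableAt_snd
    · exact (differentiableAt_fst.mul differentiableAt_snd).inv (mul_ne_zero hx.1 hx.2)
  let h : (Fin 3 → ℂ) →L[ℂ] ℂ × ℂ :=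
    (ContinuousLinearMap.proj 0).prod (ContinuousLinearMap.proj 1)
  have hhg : ∀ z, h (g z) = z := fun z => rfl
  refine isSteinManifold_of_isClosedEmbedding hd ⟨?_, ?_⟩ fun x hx => ?_
  · refine IsEmbedding.of_comp (g := h) ?_ h.continuous IsEmbedding.subtypeVal
    exact continuous_iff_continuousAt.mpr fun x =>
      (hd x x.2).continuousAt.comp continuous_subtype_val.continuousAt
  · have hrange : range (fun x : CStarSq => g x) = {y | y 0 * y 1 * y 2 = 1} := by
      ext y
      constructor
      · rintro ⟨x, rfl⟩
        exact mul_inv_cancel₀ (mul_ne_zero x.2.1 x.2.2)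
      · intro hy
        have hy' : y 0 * y 1 * y 2 = 1 := hy
        have h01 : y 0 * y 1 ≠ 0 := left_ne_zero_of_mul (hy' ▸ one_ne_zero)
        refine ⟨⟨(y 0, y 1), left_ne_zero_of_mul h01, right_ne_zero_of_mul h01⟩, ?_⟩
        ext i
        fin_cases i
        · rfl
        · rfl
        · exact inv_eq_of_mul_eq_one_right hy'
    rw [hrange]
    exact isClosed_eq (by fun_prop) continuous_const
  · have h1 : HasFDerivAt (fun z => h (g z)) (h.comp (fderiv ℂ g x)) x :=
      h.hasFDerivAt.comp x (hd x hx).hasFDerivAt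
    have h2 := h1.unique (hasFDerivAt_id x)
    exact LeftInverse.injective (g := h) fun v => DFunLike.congr_fun h2 v

theorem isClosedComplexSubmanifold_line_cStarSq :
    IsClosedComplexSubmanifold (ℂ × ℂ) {x : CStarSq | (x : ℂ × ℂ).1 + (x : ℂ × ℂ).2 = 1} := by
  let L : ℂ × ℂ →L[ℂ] Fin 1 → ℂ := ContinuousLinearMap.pi fun _ =>
    ContinuousLinearMap.fst ℂ ℂ ℂ + ContinuousLinearMap.snd ℂ ℂ ℂ
  have hL : ∀ x : ℂ × ℂ, HasFDerivAt (fun z => L z - 1) L x := fun x => L.hasFDerivAt.sub_const 1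
  refine isClosedComplexSubmanifold_of_submersion (W := univ) (g := fun z => L z - 1)
    (isClosed_eq (by fun_prop) continuous_const) isOpen_univ (fun _ _ => mem_univ _)
    (fun x _ => (hL x).differentiableAt) (fun x _ y => ⟨(y 0, 0), ?_⟩) (fun x _ => ?_)
  · rw [(hL x).fderiv]
    ext i
    rw [Subsingleton.elim i 0]
    exact add_zero (y 0)
  · constructor
    · intro hx
      ext i
      exact sub_eq_zero.mpr hx
    · intro hx
      exact sub_eq_zero.mp (congrFun hx 0)

theorem exists_continuous_avoiding {T : Set (ℂ × ℂ)} (hT : IsClosed T)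
    (hTL : ∀ z ∈ T, z.1 + z.2 ≠ 1) : ∃ g : ℂ × ℂ → ℂ × ℂ, Continuous g ∧ (∀ z, g z ∉ T) ∧
      (∀ z, z.1 + z.2 = 1 → g z = z) ∧ ∀ z, (g z).1 + (g z).2 = 1 → z.1 + z.2 = 1 := by
  rcases T.eq_empty_or_nonempty with rfl | hne
  · exact ⟨id, continuous_id, fun _ => notMem_empty _, fun _ _ => rfl, fun _ h => h⟩
  set ε : ℂ × ℂ → ℝ := fun z => infDist (z.1, 1 - z.1) T with hε
  have hεc : Continuous ε := (continuous_infDist_pt T).comp (by fun_prop)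
  have hε0 : ∀ z, 0 < ε z := fun z =>
    (hT.notMem_iff_infDist_pos hne).mp fun hz => hTL _ hz (by simp)
  set c : ℂ × ℂ → ℝ := fun z => ε z / (ε z + ‖z.1 + z.2 - 1‖) with hc
  have hden : ∀ z, 0 < ε z + ‖z.1 + z.2 - 1‖ := fun z => add_pos_of_pos_of_nonneg (hε0 z)
    (norm_nonneg _)
  have hcc : Continuous c := hεc.div (by fun_prop) fun z => (hden z).ne'
  have hc0 : ∀ z, 0 < c z := fun z => div_pos (hε0 z) (hden z)
  refine ⟨fun z => (z.1, 1 - z.1 + c z * (z.1 + z.2 - 1)), by fun_prop, fun z hz => ?_,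
    fun z hz => ?_, fun z hz => ?_⟩
  · have h1 := infDist_le_dist_of_mem (x := (z.1, 1 - z.1)) hz
    have h2 : dist (z.1, 1 - z.1) (z.1, 1 - z.1 + c z * (z.1 + z.2 - 1)) =
        c z * ‖z.1 + z.2 - 1‖ := by
      rw [Prod.dist_eq, dist_self, dist_self_add_right, norm_mul, Complex.norm_real,
        Real.norm_of_nonneg (hc0 z).le]
      exact max_eq_right (mul_nonneg (hc0 z).le (norm_nonneg _))
    have h3 : c z * ‖z.1 + z.2 - 1‖ < ε z := by
      rw [hc, div_mul_eq_mul_div, div_lt_iff₀ (hden z)]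
      nlinarith [hε0 z]
    rw [h2] at h1
    exact h1.not_gt h3
  · ext
    · rfl
    · linear_combination (c z - 1 : ℂ) * hz
  · have h1 : (c z : ℂ) * (z.1 + z.2 - 1) = 0 := by linear_combination hz
    refine sub_eq_zero.mp ((mul_eq_zero.mp h1).resolve_left ?_)
    exact_mod_cast (hc0 z).ne'

theorem not_exists_holomorphic_extension {S : Set (ℂ × ℂ)} (hp : (1, 0) ∈ S) (hq : (0, 1) ∈ S)
    (hS : ∀ F : ℂ × ℂ → ℂ × ℂ, Differentiable ℂ F → (∀ x, F x ∉ S) →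
      ∀ x, (fderiv ℂ F x).det = 0) :
    ¬ ∃ f : CStarSq → ℂ × ℂ, Holomorphic (ℂ × ℂ) (ℂ × ℂ) f ∧ (∀ x, f x ∉ S) ∧
      ∀ x : CStarSq, (x : ℂ × ℂ).1 + (x : ℂ × ℂ).2 = 1 → f x = (x : ℂ × ℂ) := by
  rintro ⟨f, hf, hfS, hfL⟩
  obtain ⟨g, hgf, hg⟩ := exists_extension_of_holomorphic hf
  set e : ℂ × ℂ → ℂ × ℂ := fun x => (Complex.exp x.1, Complex.exp x.2) with he
  have heU : ∀ x, e x ∈ CStarSq := fun x => ⟨Complex.exp_ne_zero _, Complex.exp_ne_zero _⟩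
  have hed : Differentiable ℂ e := by fun_prop
  have hFd : Differentiable ℂ fun x => g (e x) := fun x => (hg _ (heU x)).comp x (hed x)
  have hFS : ∀ x, g (e x) ∉ S := fun x => by rw [hgf ⟨e x, heU x⟩]; exact hfS _
  refine not_eq_exp_on_curve_of_periodic hFd (hS _ hFd hFS) (fun x h => hFS x (h ▸ hp))
    (fun x h => hFS x (h ▸ hq)) (fun x hx => ?_) (fun x => ?_) (fun x => ?_)
  · rw [hgf ⟨e x, heU x⟩]
    exact hfL _ hx
  · simp [he, Complex.exp_add]
  · simp [he, Complex.exp_add]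

end Axes

/-- **Example 1.** There are a discrete set `Σ ⊆ ℂ²` and a complex line `Λ ⊆ ℂ²`
meeting `{zw = 0}` exactly in `p = (1,0)` and `q = (0,1)`, with `Σ ∩ Λ = {p, q}`, such
that the inclusion `X₀ = Λ \ {p, q} ↪ ℂ² \ Σ` extends to a continuous map
`X = (ℂ*)² → ℂ² \ Σ` but to no holomorphic map `X → ℂ² \ Σ`. Consequently, for every
`n ≥ 1` there is a discrete set `Σ ⊆ ℂⁿ` for which the extension theorem (Theorem 1.1)
fails for maps of Stein manifolds into `ℂⁿ \ Σ`. -/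
theorem counterexample_discrete_complement :
    (∃ S : Set (ℂ × ℂ), IsClosedDiscrete S ∧
      ∃ Λ : Set (ℂ × ℂ), (∃ a v : ℂ × ℂ, v ≠ 0 ∧ Λ = {z | ∃ t : ℂ, z = a + t • v}) ∧
        Λ ∩ {z : ℂ × ℂ | z.1 * z.2 = 0} = {((1 : ℂ), (0 : ℂ)), ((0 : ℂ), (1 : ℂ))} ∧
        S ∩ Λ = {((1 : ℂ), (0 : ℂ)), ((0 : ℂ), (1 : ℂ))} ∧
        IsSteinManifold (ℂ × ℂ) CStarSq ∧
        IsClosedComplexSubmanifold (ℂ × ℂ) {x : CStarSq | (x : ℂ × ℂ) ∈ Λ} ∧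
        (∃ g : CStarSq → ℂ × ℂ, Continuous g ∧ (∀ x, g x ∉ S) ∧
          ∀ x : CStarSq, (x : ℂ × ℂ) ∈ Λ → g x = (x : ℂ × ℂ)) ∧
        ¬ ∃ f : CStarSq → ℂ × ℂ, Holomorphic (ℂ × ℂ) (ℂ × ℂ) f ∧
          (∀ x, f x ∉ S) ∧ ∀ x : CStarSq, (x : ℂ × ℂ) ∈ Λ → f x = (x : ℂ × ℂ)) ∧
    (∀ n : ℕ, 1 ≤ n → ∃ S : Set (Fin n → ℂ), IsClosedDiscrete S ∧
      ∃ (N : ℕ) (Xo : TopologicalSpace.Opens (Fin N → ℂ)),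
        IsSteinManifold (Fin N → ℂ) Xo ∧
        ∃ X₀ : Set Xo, IsClosedComplexSubmanifold (Fin N → ℂ) X₀ ∧
        ∃ f₀ : Xo → (Fin n → ℂ), Continuous f₀ ∧ (∀ x, f₀ x ∉ S) ∧
          HolomorphicOnSubvariety (Fin N → ℂ) (Fin n → ℂ) f₀ X₀ ∧
          ¬ ∃ F : unitInterval × Xo → (Fin n → ℂ),
            Continuous F ∧ (∀ z, F z ∉ S) ∧ (∀ x, F (0, x) = f₀ x) ∧
            Holomorphic (Fin N → ℂ) (Fin n → ℂ) (fun x => F (1, x)) ∧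
            (∀ t, ∀ x ∈ X₀, F (t, x) = f₀ x)) := by
  refine ⟨?_, exists_counterexample_in_dimension⟩
  have hdense : Dense {z : ℂ × ℂ | z.1 + z.2 = 1}ᶜ :=
    (dense_compl_singleton (1 : ℂ)).preimage
      ((ContinuousLinearMap.fst ℂ ℂ ℂ + ContinuousLinearMap.snd ℂ ℂ ℂ).isOpenMap
        fun t => ⟨(t, 0), add_zero t⟩)
  obtain ⟨T, hTfin, hTL, -, hT⟩ := exists_unavoidable_set hdense le_rfl
  have hTL' : ∀ z ∈ T, z.1 + z.2 ≠ 1 := fun z hz h => disjoint_left.mp hTL hz h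
  set P : Set (ℂ × ℂ) := {((1 : ℂ), (0 : ℂ)), ((0 : ℂ), (1 : ℂ))} with hP
  have hPL : ∀ z ∈ P, z.1 + z.2 = 1 := by
    rintro z (rfl | rfl) <;> simp
  have hline : ∀ z : ℂ × ℂ, (∃ t : ℂ, z = (1, 0) + t • (-1, 1)) ↔ z.1 + z.2 = 1 := by
    refine fun z => ⟨?_, fun h => ⟨z.2, ?_⟩⟩
    · rintro ⟨t, rfl⟩
      simp
    · ext
      · simp; linear_combination h
      · simp
  refine ⟨T ∪ P, isClosedDiscrete_of_finite_inter_closedBall fun ρ => ?_,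
    {z | z.1 + z.2 = 1}, ⟨(1, 0), (-1, 1), by simp, ?_⟩, ?_, ?_, isSteinManifold_cStarSq,
    isClosedComplexSubmanifold_line_cStarSq, ?_,
    not_exists_holomorphic_extension (by simp [hP]) (by simp [hP]) fun F hF hFS =>
      hT F hF fun x hx => hFS x (Or.inl hx)⟩
  · rw [union_inter_distrib_right]
    exact (hTfin ρ).union ((toFinite P).subset inter_subset_left)
  · ext z
    exact (hline z).symm
  · ext z
    constructor
    · rintro ⟨h1, h2⟩
      have h1' : z.1 + z.2 = 1 := h1
      rcases mul_eq_zero.mp h2 with h | h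
      · exact Or.inr (Prod.ext h (by rwa [h, zero_add] at h1'))
      · exact Or.inl (Prod.ext (by rwa [h, add_zero] at h1') h)
    · rintro (rfl | rfl) <;> simp
  · ext z
    constructor
    · rintro ⟨h | h, hz⟩
      · exact absurd hz (hTL' z h)
      · exact h
    · exact fun hz => ⟨Or.inr hz, hPL z hz⟩
  · obtain ⟨g, hgc, hgT, hgL, hgL'⟩ :=
      exists_continuous_avoiding (isClosedDiscrete_of_finite_inter_closedBall hTfin).1 hTL'
    refine ⟨fun x => g x, hgc.comp continuous_subtype_val, fun x hx => ?_, fun x hx => hgL x hx⟩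
    rcases hx with hx | hx
    · exact hgT _ hx
    · have h1 := hgL x (hgL' x (hPL _ hx))
      have hx' : g x ∈ P := hx
      rw [h1] at hx'
      rcases hx' with hx | hx
      · exact x.2.2 (congrArg Prod.snd hx)
      · exact x.2.1 (congrArg Prod.fst hx)
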